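/- There exist absolute constants β, C > 0 such that lim_{n→∞} inf_{λ} P( n^{1/4} ≤ L(n,λ) ≤ C·n·(λ − e^{−1}) ) = 1, where the infimum is over all λ ≥ e^{−1} + β·(log n)^{−2}. -/

import Mathlib

open MeasureTheory ProbabilityTheory Filter Finset

namespace Paper

/-- A path of length `ℓ` in the complete graph on `Fin n`: a sequence of `ℓ+1` distinct
vertices. -/
abbrev Path (n ℓ : ℕ) := {v : Fin (ℓ + 1) → Fin n // Function.Injective v}

/-- The `i`-th edge of a path. -/
def Path.edge {n ℓ : ℕ} (γ : Path n ℓ) (i : Fin ℓ) : Sym2 (Fin n) :=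
  s(γ.1 i.castSucc, γ.1 i.succ)

/-- The total weight `X(γ)` of a path. -/
noncomputable def weight {n ℓ : ℕ} (ω : Sym2 (Fin n) → ℝ) (γ : Path n ℓ) : ℝ :=
  ∑ i : Fin ℓ, ω (γ.edge i)

/-- Partial sum of the first `k` edge weights of a path. -/
noncomputable def partialSum {n ℓ : ℕ} (ω : Sym2 (Fin n) → ℝ) (γ : Path n ℓ) (k : ℕ) : ℝ :=
  ∑ i : Fin ℓ, if (i : ℕ) < k then ω (γ.edge i) else 0

/-- The deviation `M(γ) = max_{1 ≤ k ≤ ℓ} |∑_{i=1}^k X_{e_i} - (k/ℓ) X(γ)|`. -/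
noncomputable def deviation {n ℓ : ℕ} (ω : Sym2 (Fin n) → ℝ) (γ : Path n ℓ) : ℝ :=
  ⨆ k : Fin ℓ, |partialSum ω γ ((k : ℕ) + 1) - (((k : ℕ) + 1 : ℝ) / ℓ) * weight ω γ|

/-- The law of the i.i.d. edge weights: each edge carries an exponential variable with
mean `n` (rate `1/n`). -/
noncomputable def P (n : ℕ) : Measure (Sym2 (Fin n) → ℝ) :=
  Measure.pi fun _ => expMeasure ((n : ℝ)⁻¹)

/-- `L n λ ω` : the maximal `ℓ` such that some path of length `ℓ` has weight at most `λℓ`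
(`0` if there is none). -/
noncomputable def L (n : ℕ) (lam : ℝ) (ω : Sym2 (Fin n) → ℝ) : ℕ :=
  sSup {ℓ : ℕ | ∃ γ : Path n ℓ, weight ω γ ≤ lam * ℓ}
section helpers
open scoped ENNReal NNReal
set_option linter.unusedSectionVars false




section coord
variable {ι : Type*} [Fintype ι] [DecidableEq ι]

lemma lintegral_coord (μ : Measure ℝ) [IsProbabilityMeasure μ] (e : ι)
    (G : (ι → ℝ) → ℝ≥0∞) (hG : Measurable G) :
    ∫⁻ ω, G ω ∂(Measure.pi fun _ : ι => μ)
      = ∫⁻ ω, (∫⁻ t, G (Function.update ω e t) ∂μ) ∂(Measure.pi fun _ : ι => μ) := by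
  have h1 : Measurable (∫⋯∫⁻_{e}, G ∂(fun _ : ι => μ)) := hG.lmarginal _
  have h := lintegral_eq_of_lmarginal_eq (μ := fun _ : ι => μ) {e} hG h1 (by
    funext x
    simp only [lmarginal_singleton]
    simp)
  rw [h]
  refine lintegral_congr fun ω => ?_
  rw [lmarginal_singleton]

end coord

section lists
variable {n : ℕ}

/-- total weight of a vertex list -/
noncomputable def lS (ω : Sym2 (Fin n) → ℝ) : List (Fin n) → ℝ
  | [] => 0
  | [_] => 0
  | u :: b :: l => ω s(u, b) + lS ω (b :: l)

/-- edges of a vertex list -/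
def lE : List (Fin n) → List (Sym2 (Fin n))
  | [] => []
  | [_] => []
  | u :: b :: l => s(u, b) :: lE (b :: l)

/-- remaining budget -/
noncomputable def lY (lam : ℝ) (ω : Sym2 (Fin n) → ℝ) (l : List (Fin n)) : ℝ :=
  lam * l.length - lS ω l

noncomputable def lU (lam : ℝ) (Φ D : ℝ → ℝ≥0∞) (ω : Sym2 (Fin n) → ℝ) : List (Fin n) → ℝ≥0∞
  | [] => 1
  | [_] => 1
  | _ :: b :: l => Φ (lY lam ω (b :: l)) * (D (lY lam ω (b :: l)))⁻¹ * lU lam Φ D ω (b :: l)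

noncomputable def lW (lam : ℝ) (Φ D : ℝ → ℝ≥0∞) (ω : Sym2 (Fin n) → ℝ) (l : List (Fin n)) :
    ℝ≥0∞ := Φ (lY lam ω l) * lU lam Φ D ω l

lemma lY_single (lam : ℝ) (ω : Sym2 (Fin n) → ℝ) (a : Fin n) : lY lam ω [a] = lam := by
  simp [lY, lS]

lemma lY_cons (lam : ℝ) (ω : Sym2 (Fin n) → ℝ) (u b : Fin n) (l : List (Fin n)) :
    lY lam ω (u :: b :: l) = lY lam ω (b :: l) + lam - ω s(u, b) := by
  simp [lY, lS]; ring

lemma mem_of_mem_lE (l : List (Fin n)) (e : Sym2 (Fin n)) (he : e ∈ lE l) (u : Fin n)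
    (hu : u ∈ e) : u ∈ l := by
  induction l with
  | nil => simp [lE] at he
  | cons a l ih =>
    cases l with
    | nil => simp [lE] at he
    | cons b l =>
      simp only [lE, List.mem_cons] at he
      rcases he with rfl | he
      · simp only [Sym2.mem_iff] at hu
        rcases hu with rfl | rfl <;> simp
      · exact List.mem_cons_of_mem _ (ih he)

lemma lS_update (l : List (Fin n)) (e : Sym2 (Fin n)) (he : e ∉ lE l) (ω : Sym2 (Fin n) → ℝ)
    (t : ℝ) : lS (Function.update ω e t) l = lS ω l := by
  induction l with
  | nil => rfl
  | cons a l ih =>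
    cases l with
    | nil => rfl
    | cons b l =>
      simp only [lE, List.mem_cons, not_or] at he
      simp only [lS]
      rw [ih he.2, Function.update_of_ne (Ne.symm he.1)]

lemma lY_update (lam : ℝ) (l : List (Fin n)) (e : Sym2 (Fin n)) (he : e ∉ lE l)
    (ω : Sym2 (Fin n) → ℝ) (t : ℝ) : lY lam (Function.update ω e t) l = lY lam ω l := by
  simp [lY, lS_update l e he]

lemma lU_update (lam : ℝ) (Φ D : ℝ → ℝ≥0∞) (l : List (Fin n)) (e : Sym2 (Fin n)) (he : e ∉ lE l)
    (ω : Sym2 (Fin n) → ℝ) (t : ℝ) :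
    lU lam Φ D (Function.update ω e t) l = lU lam Φ D ω l := by
  induction l with
  | nil => rfl
  | cons a l ih =>
    cases l with
    | nil => rfl
    | cons b l =>
      simp only [lE, List.mem_cons, not_or] at he
      simp only [lU]
      rw [ih he.2, lY_update _ _ _ he.2]

lemma lW_update (lam : ℝ) (Φ D : ℝ → ℝ≥0∞) (l : List (Fin n)) (e : Sym2 (Fin n)) (he : e ∉ lE l)
    (ω : Sym2 (Fin n) → ℝ) (t : ℝ) :
    lW lam Φ D (Function.update ω e t) l = lW lam Φ D ω l := by
  simp [lW, lU_update _ _ _ l e he, lY_update _ l e he]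

lemma measurable_lS (l : List (Fin n)) : Measurable fun ω : Sym2 (Fin n) → ℝ => lS ω l := by
  induction l with
  | nil => exact measurable_const
  | cons a l ih =>
    cases l with
    | nil => exact measurable_const
    | cons b l => exact (measurable_pi_apply _).add ih

lemma measurable_lY (lam : ℝ) (l : List (Fin n)) :
    Measurable fun ω : Sym2 (Fin n) → ℝ => lY lam ω l :=
  measurable_const.sub (measurable_lS l)

lemma measurable_lU (lam : ℝ) (Φ D : ℝ → ℝ≥0∞) (hΦ : Measurable Φ) (hD : Measurable D)
    (l : List (Fin n)) : Measurable fun ω : Sym2 (Fin n) → ℝ => lU lam Φ D ω l := by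
  induction l with
  | nil => exact measurable_const
  | cons a l ih =>
    cases l with
    | nil => exact measurable_const
    | cons b l =>
      exact ((hΦ.comp (measurable_lY lam _)).mul (hD.comp (measurable_lY lam _)).inv).mul ih

lemma measurable_lW (lam : ℝ) (Φ D : ℝ → ℝ≥0∞) (hΦ : Measurable Φ) (hD : Measurable D)
    (l : List (Fin n)) : Measurable fun ω : Sym2 (Fin n) → ℝ => lW lam Φ D ω l :=
  (hΦ.comp (measurable_lY lam _)).mul (measurable_lU lam Φ D hΦ hD l)

/-- Abstract hypotheses on the kernel. -/
structure Ker (μ : Measure ℝ) (lam : ℝ) (Φ D : ℝ → ℝ≥0∞) (N B : ℝ≥0) : Prop where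
  mΦ : Measurable Φ
  mD : Measurable D
  hD : ∀ y, D y = ∫⁻ t, Φ (y + lam - t) ∂μ
  le : ∀ y, Φ y ≤ N * D y
  leB : ∀ y, Φ y ≤ B
  one_le : ∀ y, Φ y ≠ 0 → 1 ≤ Φ y
  start : Φ lam = 1

variable {μ : Measure ℝ} [IsProbabilityMeasure μ] {lam : ℝ} {Φ D : ℝ → ℝ≥0∞} {N B : ℝ≥0}

lemma Ker.D_ne_top (K : Ker μ lam Φ D N B) (y : ℝ) : D y ≠ ⊤ := by
  rw [K.hD]
  refine ne_top_of_le_ne_top (b := (B : ℝ≥0∞)) ENNReal.coe_ne_top ?_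
  calc _ ≤ ∫⁻ t, (B : ℝ≥0∞) ∂μ := lintegral_mono fun t => K.leB _
    _ = B := by simp

lemma Ker.cancel (K : Ker μ lam Φ D N B) (y : ℝ) : Φ y * (D y)⁻¹ * D y = Φ y := by
  by_cases h : D y = 0
  · have := K.le y
    rw [h] at this
    simp at this
    simp [this]
  · rw [mul_assoc, ENNReal.inv_mul_cancel h (K.D_ne_top y), mul_one]

lemma Ker.le_N (K : Ker μ lam Φ D N B) (y : ℝ) : Φ y * (D y)⁻¹ ≤ N := by
  rw [← div_eq_mul_inv]
  exact ENNReal.div_le_of_le_mul (K.le y)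

lemma Ker.le_N' (K : Ker μ lam Φ D N B) (y : ℝ) : Φ y * (D y)⁻¹ ≤ N * Φ y := by
  by_cases h : Φ y = 0
  · simp [h]
  · calc _ ≤ (N : ℝ≥0∞) * 1 := by simpa using K.le_N y
      _ ≤ _ := by gcongr; exact K.one_le y h

/-- Integrating out a fresh edge. -/
lemma Ker.fresh (K : Ker μ lam Φ D N B) (F : (Sym2 (Fin n) → ℝ) → ℝ≥0∞) (hF : Measurable F)
    (u b : Fin n) (l : List (Fin n)) (hu : u ∉ b :: l)
    (hFe : ∀ ω t, F (Function.update ω s(u, b) t) = F ω) :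
    ∫⁻ ω, F ω * lW lam Φ D ω (u :: b :: l) ∂(Measure.pi fun _ => μ)
      = ∫⁻ ω, F ω * lW lam Φ D ω (b :: l) ∂(Measure.pi fun _ => μ) := by
  have he : s(u, b) ∉ lE (b :: l) := fun h => hu (mem_of_mem_lE _ _ h u (by simp))
  rw [lintegral_coord μ s(u, b) (fun ω => F ω * lW lam Φ D ω (u :: b :: l))
    (hF.mul (measurable_lW lam Φ D K.mΦ K.mD _))]
  refine lintegral_congr fun ω => ?_
  have : ∀ t, F (Function.update ω s(u, b) t) * lW lam Φ D (Function.update ω s(u, b) t) (u :: b :: l)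
      = (F ω * (Φ (lY lam ω (b :: l)) * (D (lY lam ω (b :: l)))⁻¹ * lU lam Φ D ω (b :: l))) *
        Φ (lY lam ω (b :: l) + lam - t) := by
    intro t
    rw [hFe, lW, lU, lY_cons, lY_update _ _ _ he, lU_update _ _ _ _ _ he, Function.update_self]
    ring
  simp_rw [this]
  have hm : Measurable fun t => Φ (lY lam ω (b :: l) + lam - t) :=
    K.mΦ.comp (measurable_const.sub measurable_id)
  rw [lintegral_const_mul _ hm, ← K.hD, lW]
  calc _ = F ω * (Φ (lY lam ω (b :: l)) * (D (lY lam ω (b :: l)))⁻¹ * D (lY lam ω (b :: l)) *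
      lU lam Φ D ω (b :: l)) := by ring
    _ = _ := by rw [K.cancel]

lemma Ker.mean (K : Ker μ lam Φ D N B) (l : List (Fin n)) (hl : l ≠ []) (hn : l.Nodup) :
    ∫⁻ ω, lW lam Φ D ω l ∂(Measure.pi fun _ => μ) = 1 := by
  induction l with
  | nil => exact absurd rfl hl
  | cons a l ih =>
    cases l with
    | nil => simp [lW, lU, lY_single, K.start]
    | cons b l =>
      have := K.fresh (fun _ => 1) measurable_const a b l (List.nodup_cons.1 hn).1 (fun _ _ => rfl)
      simp only [one_mul] at this
      rw [this]
      exact ih (by simp) (List.nodup_cons.1 hn).2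

def lastSh (E : Set (Sym2 (Fin n))) : List (Fin n) → Prop
  | [] => False
  | [_] => False
  | u :: b :: _ => s(u, b) ∈ E

open Classical in
noncomputable def lM (N B : ℝ≥0) (E : Set (Sym2 (Fin n))) : List (Fin n) → ℝ≥0
  | [] => 1
  | [_] => 1
  | u :: b :: l => (if s(u, b) ∈ E then (if lastSh E (b :: l) then N else N * B) else 1)
      * lM N B E (b :: l)

lemma Ker.pair (K : Ker μ lam Φ D N B) (g : List (Fin n)) (hg : g ≠ []) (hgn : g.Nodup)
    (l : List (Fin n)) (hl : l ≠ []) (hn : l.Nodup) :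
    (∫⁻ ω, lW lam Φ D ω g * lW lam Φ D ω l ∂(Measure.pi fun _ => μ)
        ≤ lM N B {e | e ∈ lE g} l) ∧
    (lastSh {e | e ∈ lE g} l →
      B * ∫⁻ ω, lW lam Φ D ω g * lU lam Φ D ω l ∂(Measure.pi fun _ => μ)
        ≤ lM N B {e | e ∈ lE g} l) := by
  induction l with
  | nil => exact absurd rfl hl
  | cons u l ih =>
    cases l with
    | nil =>
      refine ⟨?_, fun h => h.elim⟩
      simp [lM, lW, lU, lY_single, K.start]
      have := K.mean g hg hgn
      simp only [lW] at this
      exact this.le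
    | cons b l =>
      have hu := (List.nodup_cons.1 hn).1
      obtain ⟨ih1, ih2⟩ := ih (by simp) (List.nodup_cons.1 hn).2
      by_cases hs : s(u, b) ∈ lE g
      · -- shared edge
        have key : B * ∫⁻ ω, lW lam Φ D ω g * lU lam Φ D ω (u :: b :: l) ∂(Measure.pi fun _ => μ)
            ≤ lM N B {e | e ∈ lE g} (u :: b :: l) := by
          by_cases hp : lastSh {e | e ∈ lE g} (b :: l)
          · have : lM N B {e | e ∈ lE g} (u :: b :: l) = N * lM N B {e | e ∈ lE g} (b :: l) := by
              simp [lM, hs, hp]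
            rw [this]
            push_cast
            calc _ ≤ (B : ℝ≥0∞) * ∫⁻ ω, N * (lW lam Φ D ω g * lU lam Φ D ω (b :: l))
                    ∂(Measure.pi fun _ => μ) := by
                  refine mul_le_mul' le_rfl (lintegral_mono fun ω => ?_)
                  calc _ = lW lam Φ D ω g * ((Φ (lY lam ω (b :: l)) * (D (lY lam ω (b :: l)))⁻¹) *
                        lU lam Φ D ω (b :: l)) := rfl
                    _ ≤ lW lam Φ D ω g * (N * lU lam Φ D ω (b :: l)) := by
                        gcongr; exact K.le_N _
                    _ = _ := by ring
              _ = N * (B * ∫⁻ ω, lW lam Φ D ω g * lU lam Φ D ω (b :: l)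
                    ∂(Measure.pi fun _ => μ)) := by
                  rw [lintegral_const_mul' _ _ ENNReal.coe_ne_top]; ring
              _ ≤ _ := by gcongr; exact ih2 hp
          · have : lM N B {e | e ∈ lE g} (u :: b :: l) = N * B * lM N B {e | e ∈ lE g} (b :: l) := by
              simp [lM, hs, hp]
            rw [this]
            push_cast
            calc _ ≤ (B : ℝ≥0∞) * ∫⁻ ω, N * (lW lam Φ D ω g * lW lam Φ D ω (b :: l))
                    ∂(Measure.pi fun _ => μ) := by
                  refine mul_le_mul' le_rfl (lintegral_mono fun ω => ?_)
                  calc _ = lW lam Φ D ω g * ((Φ (lY lam ω (b :: l)) * (D (lY lam ω (b :: l)))⁻¹) *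
                        lU lam Φ D ω (b :: l)) := rfl
                    _ ≤ lW lam Φ D ω g * ((N * Φ (lY lam ω (b :: l))) * lU lam Φ D ω (b :: l)) := by
                        refine mul_le_mul' le_rfl (mul_le_mul' ?_ le_rfl); exact K.le_N' _
                    _ = _ := by simp only [lW]; ring
              _ = N * B * (∫⁻ ω, lW lam Φ D ω g * lW lam Φ D ω (b :: l)
                    ∂(Measure.pi fun _ => μ)) := by
                  rw [lintegral_const_mul' _ _ ENNReal.coe_ne_top]; ring
              _ ≤ _ := by gcongr
        refine ⟨le_trans ?_ key, fun _ => key⟩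
        rw [← lintegral_const_mul' _ _ ENNReal.coe_ne_top]
        refine lintegral_mono fun ω => ?_
        calc lW lam Φ D ω g * lW lam Φ D ω (u :: b :: l)
            = lW lam Φ D ω g * (Φ (lY lam ω (u :: b :: l)) * lU lam Φ D ω (u :: b :: l)) := rfl
          _ ≤ lW lam Φ D ω g * (B * lU lam Φ D ω (u :: b :: l)) := by gcongr; exact K.leB _
          _ = _ := by ring
      · refine ⟨?_, fun h => absurd h hs⟩
        have : lM N B {e | e ∈ lE g} (u :: b :: l) = lM N B {e | e ∈ lE g} (b :: l) := by
          simp [lM, hs]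
        rw [this, K.fresh _ (measurable_lW lam Φ D K.mΦ K.mD g) u b l hu
          (fun ω t => lW_update lam Φ D g _ hs ω t)]
        exact ih1

end lists

section counting
open Classical
variable {n : ℕ}

lemma deg_le (g : List (Fin n)) (hg : g.Nodup) :
    (∀ x, (univ.filter fun w => s(w, x) ∈ lE g).card ≤ 2) ∧
    (∀ x, g.head? = some x → (univ.filter fun w => s(w, x) ∈ lE g).card ≤ 1) := by
  induction g with
  | nil => simp [lE]
  | cons u g ih =>
    cases g with
    | nil => simp [lE]
    | cons b l =>
      obtain ⟨h2, h1⟩ := ih (List.nodup_cons.1 hg).2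
      have hu := (List.nodup_cons.1 hg).1
      have h1 := h1 b rfl
      have hub : u ≠ b := by rintro rfl; simp at hu
      have hsub : ∀ x, (univ.filter fun w => s(w, x) ∈ lE (u :: b :: l)) ⊆
          (univ.filter fun w => s(w, x) = s(u, b)) ∪ (univ.filter fun w => s(w, x) ∈ lE (b :: l)) := by
        intro x w hw
        simpa [lE] using hw
      have hu1 : (univ.filter fun w => s(w, u) ∈ lE (u :: b :: l)).card ≤ 1 := by
        have : (univ.filter fun w => s(w, u) ∈ lE (u :: b :: l)) ⊆ {b} := by
          intro w hw
          simp only [lE, List.mem_cons, mem_filter, mem_univ, true_and, Finset.mem_singleton] at hw ⊢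
          rcases hw with hw | hw
          · rw [Sym2.eq_iff] at hw
            rcases hw with ⟨h, h'⟩ | ⟨h, h'⟩
            · exact absurd h' hub
            · exact h
          · exact absurd (mem_of_mem_lE _ _ hw u (by simp)) hu
        simpa using Finset.card_le_card this
      refine ⟨fun x => ?_, fun x hx => ?_⟩
      · by_cases hxu : x = u
        · subst hxu; omega
        · by_cases hxb : x = b
          · subst hxb
            have hc : (univ.filter fun w => s(w, x) = s(u, x)).card ≤ 1 := by
              have : (univ.filter fun w => s(w, x) = s(u, x)) ⊆ {u} := by
                intro w hw
                simp only [mem_filter, mem_univ, true_and, Finset.mem_singleton] at hw ⊢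
                rw [Sym2.eq_iff] at hw
                rcases hw with ⟨h, h'⟩ | ⟨h, h'⟩
                · exact h
                · exact absurd h'.symm hub
              simpa using Finset.card_le_card this
            have := (Finset.card_le_card (hsub x)).trans (Finset.card_union_le _ _)
            omega
          · have : (univ.filter fun w => s(w, x) ∈ lE (u :: b :: l)) ⊆
                (univ.filter fun w => s(w, x) ∈ lE (b :: l)) := by
              intro w hw
              simp only [lE, List.mem_cons, mem_filter, mem_univ, true_and] at hw ⊢
              rcases hw with hw | hw
              · rw [Sym2.eq_iff] at hw
                rcases hw with ⟨h, h'⟩ | ⟨h, h'⟩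
                · exact absurd h' hxb
                · exact absurd h' hxu
              · exact hw
            exact (Finset.card_le_card this).trans (h2 x)
      · simp at hx; subst hx; exact hu1

noncomputable def mm (N B : ℝ≥0) (E : Set (Sym2 (Fin n))) (l : List (Fin n)) : ℝ≥0 :=
  if l.Nodup then lM N B E l else 0

variable {N B : ℝ≥0}

lemma mm_cons_fresh (E : Set (Sym2 (Fin n))) (u b : Fin n) (l : List (Fin n))
    (h : s(u, b) ∉ E) : mm N B E (u :: b :: l) ≤ mm N B E (b :: l) := by
  unfold mm
  by_cases hn : (u :: b :: l).Nodup
  · rw [if_pos hn, if_pos (List.nodup_cons.1 hn).2]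
    simp [lM, h]
  · rw [if_neg hn]; exact zero_le

lemma mm_cons_shared (E : Set (Sym2 (Fin n))) (u b : Fin n) (l : List (Fin n))
    (h : s(u, b) ∈ E) : mm N B E (u :: b :: l) ≤
      (if lastSh E (b :: l) then N else N * B) * mm N B E (b :: l) := by
  unfold mm
  by_cases hn : (u :: b :: l).Nodup
  · rw [if_pos hn, if_pos (List.nodup_cons.1 hn).2]
    simp [lM, h]
  · rw [if_neg hn]; exact zero_le

lemma step_T (E : Set (Sym2 (Fin n))) (b : Fin n) (l : List (Fin n)) :
    ∑ u, mm N B E (u :: b :: l) ≤ n * mm N B E (b :: l)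
      + ∑ u, if lastSh E (u :: b :: l) then mm N B E (u :: b :: l) else 0 := by
  calc _ ≤ ∑ u : Fin n, (mm N B E (b :: l)
        + if lastSh E (u :: b :: l) then mm N B E (u :: b :: l) else 0) := by
        refine Finset.sum_le_sum fun u _ => ?_
        by_cases h : s(u, b) ∈ E
        · simp [lastSh, h]
        · simpa [lastSh, h] using mm_cons_fresh E u b l h
    _ = _ := by simp [Finset.sum_add_distrib]

lemma step_O (g : List (Fin n)) (hg : g.Nodup) (E : Set (Sym2 (Fin n))) (b : Fin n) (l : List (Fin n)) :
    ∑ u, (if ¬ lastSh E (u :: b :: l) ∧ u ∈ g then mm N B E (u :: b :: l) else 0)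
      ≤ g.length * mm N B E (b :: l) := by
  calc _ ≤ ∑ u : Fin n, (if u ∈ g then mm N B E (b :: l) else 0) := by
        refine Finset.sum_le_sum fun u _ => ?_
        by_cases h : s(u, b) ∈ E
        · simp [lastSh, h]
        · by_cases hu : u ∈ g
          · simpa [lastSh, h, hu] using mm_cons_fresh E u b l h
          · simp [hu]
    _ = _ := by
      rw [← Finset.sum_filter, Finset.sum_const, nsmul_eq_mul]
      congr 2
      rw [← List.toFinset_card_of_nodup hg]
      congr 1
      ext; simp

lemma step_S (g : List (Fin n)) (hg : g.Nodup) (b : Fin n) (l : List (Fin n)) :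
    ∑ u, (if lastSh {e | e ∈ lE g} (u :: b :: l) then mm N B {e | e ∈ lE g} (u :: b :: l) else 0)
      ≤ N * (if lastSh {e | e ∈ lE g} (b :: l) then mm N B {e | e ∈ lE g} (b :: l) else 0)
      + 2 * N * B * (if ¬ lastSh {e | e ∈ lE g} (b :: l) ∧ b ∈ g then
          mm N B {e | e ∈ lE g} (b :: l) else 0) := by
  set E := {e | e ∈ lE g} with hE
  by_cases hs : lastSh E (b :: l)
  · simp only [hs, not_true, false_and, if_true, if_false, mul_zero, add_zero]
    cases l with
    | nil => exact absurd hs (by simp [lastSh])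
    | cons c l =>
      have hbc : s(b, c) ∈ lE g := hs
      have hcard : ((univ.filter fun w => s(w, b) ∈ lE g).erase c).card ≤ 1 := by
        rw [Finset.card_erase_of_mem]
        · have := (deg_le g hg).1 b
          omega
        · simp only [mem_filter, mem_univ, true_and]
          rwa [Sym2.eq_swap]
      calc _ ≤ ∑ u : Fin n, (if u ∈ (univ.filter fun w => s(w, b) ∈ lE g).erase c then
              N * mm N B E (b :: c :: l) else 0) := by
            refine Finset.sum_le_sum fun u _ => ?_
            by_cases h : s(u, b) ∈ E
            · by_cases hc : u = c
              · subst hc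
                simp [mm]
              · have h' : s(u, b) ∈ lE g := h
                have := mm_cons_shared (N := N) (B := B) E u b (c :: l) h
                rw [if_pos hs] at this
                simpa [lastSh, h, hc, h'] using this
            · have h' : s(u, b) ∉ lE g := h
              simp [lastSh, h]
        _ = (((univ.filter fun w => s(w, b) ∈ lE g).erase c).card : ℝ≥0) *
              (N * mm N B E (b :: c :: l)) := by
            rw [← Finset.sum_filter, Finset.sum_const, nsmul_eq_mul]
            congr 3
            ext; simp
        _ ≤ 1 * (N * mm N B E (b :: c :: l)) := by
            gcongr; exact_mod_cast hcard
        _ = _ := one_mul _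
  · simp only [hs, not_false_eq_true, true_and, if_false, mul_zero, zero_add]
    by_cases hb : b ∈ g
    · simp only [hb, if_true]
      calc _ ≤ ∑ u : Fin n, (if s(u, b) ∈ lE g then
              N * B * mm N B E (b :: l) else 0) := by
            refine Finset.sum_le_sum fun u _ => ?_
            by_cases h : s(u, b) ∈ E
            · have h' : s(u, b) ∈ lE g := h
              have := mm_cons_shared (N := N) (B := B) E u b l h
              rw [if_neg hs] at this
              simpa [lastSh, h, h'] using this
            · simp [lastSh, h]
        _ = ((univ.filter fun w => s(w, b) ∈ lE g).card : ℝ≥0) *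
              (N * B * mm N B E (b :: l)) := by
            rw [← Finset.sum_filter, Finset.sum_const, nsmul_eq_mul]
        _ ≤ 2 * (N * B * mm N B E (b :: l)) := by
            gcongr; exact_mod_cast (deg_le g hg).1 b
        _ = _ := by ring
    · refine le_of_eq_of_le ?_ zero_le
      refine Finset.sum_eq_zero fun u _ => ?_
      rw [if_neg]
      intro h
      exact hb (mem_of_mem_lE g s(u, b) h b (by simp))

lemma sum_cons (k : ℕ) (F : List (Fin n) → ℝ≥0) :
    ∑ v : Fin (k + 1) → Fin n, F (List.ofFn v) =
      ∑ v : Fin k → Fin n, ∑ u : Fin n, F (u :: List.ofFn v) := by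
  rw [← (Fin.consEquiv (fun _ : Fin (k + 1) => Fin n)).sum_comp, Fintype.sum_prod_type_right]
  refine Finset.sum_congr rfl fun v _ => Finset.sum_congr rfl fun u _ => ?_
  congr 1
  simp [Fin.consEquiv, List.ofFn_succ]

noncomputable def cT (N B : ℝ≥0) (E : Set (Sym2 (Fin n))) (k : ℕ) : ℝ≥0 :=
  ∑ v : Fin (k + 1) → Fin n, mm N B E (List.ofFn v)

noncomputable def cS (N B : ℝ≥0) (E : Set (Sym2 (Fin n))) (k : ℕ) : ℝ≥0 :=
  ∑ v : Fin (k + 1) → Fin n, if lastSh E (List.ofFn v) then mm N B E (List.ofFn v) else 0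

noncomputable def cO (N B : ℝ≥0) (E : Set (Sym2 (Fin n))) (g : List (Fin n)) (k : ℕ) : ℝ≥0 :=
  ∑ v : Fin (k + 1) → Fin n, if ¬ lastSh E (List.ofFn v) ∧ v 0 ∈ g then
    mm N B E (List.ofFn v) else 0

lemma cT_succ (E : Set (Sym2 (Fin n))) (k : ℕ) :
    cT N B E (k + 1) ≤ n * cT N B E k + cS N B E (k + 1) := by
  unfold cT cS
  rw [sum_cons (k + 1) (fun l => mm N B E l),
    sum_cons (k + 1) (fun l => if lastSh E l then mm N B E l else 0), Finset.mul_sum,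
    ← Finset.sum_add_distrib]
  refine Finset.sum_le_sum fun v _ => ?_
  simp only [List.ofFn_succ]
  exact step_T E _ _

lemma cS_succ (g : List (Fin n)) (hg : g.Nodup) (k : ℕ) :
    cS N B {e | e ∈ lE g} (k + 1) ≤
      N * cS N B {e | e ∈ lE g} k + 2 * N * B * cO N B {e | e ∈ lE g} g k := by
  unfold cS cO
  rw [sum_cons (k + 1) (fun l => if lastSh {e | e ∈ lE g} l then mm N B {e | e ∈ lE g} l else 0),
    Finset.mul_sum, Finset.mul_sum, ← Finset.sum_add_distrib]
  refine Finset.sum_le_sum fun v _ => ?_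
  simp only [List.ofFn_succ]
  exact step_S g hg _ _

lemma cO_succ (g : List (Fin n)) (hg : g.Nodup) (E : Set (Sym2 (Fin n))) (k : ℕ) :
    cO N B E g (k + 1) ≤ g.length * cT N B E k := by
  unfold cT cO
  have := sum_cons (n := n) (k + 1) (fun l => if ¬ lastSh E l ∧ (∃ x ∈ l.head?, x ∈ g) then mm N B E l else 0)
  simp only [List.ofFn_succ (n := k + 1), List.head?_cons] at this ⊢
  simp only [Option.mem_def, Option.some.injEq, exists_eq_left'] at this
  rw [this, Finset.mul_sum]
  refine Finset.sum_le_sum fun v _ => ?_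
  simp only [List.ofFn_succ]
  exact step_O g hg E _ _

lemma cT_zero (E : Set (Sym2 (Fin n))) : cT N B E 0 = n := by
  unfold cT mm
  simp [lM]

lemma cS_zero (E : Set (Sym2 (Fin n))) : cS N B E 0 = 0 := by
  unfold cS
  simp [lastSh]

lemma cO_zero (g : List (Fin n)) (hg : g.Nodup) (E : Set (Sym2 (Fin n))) :
    cO N B E g 0 ≤ g.length := by
  unfold cO mm
  simp only [List.ofFn_succ, List.ofFn_zero, lastSh, lM, not_false_eq_true, true_and,
    List.nodup_singleton, if_true]
  rw [← (Equiv.funUnique (Fin 1) (Fin n)).symm.sum_comp]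
  simp only [Equiv.funUnique_symm_apply, uniqueElim_const]
  rw [← Finset.sum_filter, Finset.sum_const, nsmul_eq_mul, mul_one]
  rw [← List.toFinset_card_of_nodup hg]
  apply le_of_eq
  congr 2
  ext; simp

lemma cT_bound (hn : 0 < n) (g : List (Fin n)) (hg : g.Nodup) (m : ℕ) (hm : g.length = m + 1)
    (τ ρ : ℝ) (hτ : 1 ≤ τ) (hN : (N : ℝ) = τ * n)
    (hρ : ρ = τ ^ m * m * (2 * B * (m + 1) / n)) :
    (cT N B {e | e ∈ lE g} m : ℝ) ≤ (n : ℝ) ^ (m + 1) * (1 + ρ) ^ m := by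
  set E := {e | e ∈ lE g}
  have hn' : (0 : ℝ) < n := by exact_mod_cast hn
  set κ : ℝ := 2 * B * (m + 1) / n with hκ
  have hκn : κ * n = 2 * B * (m + 1) := by rw [hκ]; field_simp
  have hκ0 : 0 ≤ κ := by positivity
  have hρ0 : 0 ≤ ρ := by rw [hρ]; positivity
  have main : ∀ k ≤ m, (cT N B E k : ℝ) ≤ (n : ℝ) ^ (k + 1) * (1 + ρ) ^ k ∧
      (cS N B E k : ℝ) ≤ (n : ℝ) ^ (k + 1) * (τ ^ k * k * κ * (1 + ρ) ^ k) ∧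
      (cO N B E g k : ℝ) ≤ (m + 1) * (n : ℝ) ^ k * (1 + ρ) ^ k := by
    intro k
    induction k with
    | zero =>
      intro _
      refine ⟨by simp [cT_zero], by simp [cS_zero], ?_⟩
      have := cO_zero (N := N) (B := B) g hg E
      rw [hm] at this
      have h2 : (cO N B E g 0 : ℝ) ≤ ((m + 1 : ℕ) : ℝ) := by exact_mod_cast this
      simpa using h2
    | succ k ih =>
      intro hk
      obtain ⟨iT, iS, iO⟩ := ih (by omega)
      have sT : (cT N B E (k + 1) : ℝ) ≤ n * cT N B E k + cS N B E (k + 1) := by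
        exact_mod_cast cT_succ (N := N) (B := B) E k
      have sS : (cS N B E (k + 1) : ℝ) ≤ N * cS N B E k + 2 * N * B * cO N B E g k := by
        exact_mod_cast cS_succ (N := N) (B := B) g hg k
      have sO : (cO N B E g (k + 1) : ℝ) ≤ ((m + 1 : ℕ) : ℝ) * cT N B E k := by
        rw [← hm]
        exact_mod_cast cO_succ (N := N) (B := B) g hg E k
      push_cast at sO
      set r := (1 + ρ) ^ k with hr
      have hr0 : 0 ≤ r := by positivity
      have hrr : r ≤ (1 + ρ) ^ (k + 1) := by
        rw [pow_succ]; nlinarith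
      have hτk : τ ≤ τ ^ (k + 1) := by
        simpa using pow_le_pow_right₀ hτ (show 1 ≤ k + 1 by omega)
      have bS : (cS N B E (k + 1) : ℝ) ≤ (n : ℝ) ^ (k + 2) * (τ ^ (k + 1) * (k + 1) * κ * r) := by
        calc (cS N B E (k + 1) : ℝ) ≤ N * cS N B E k + 2 * N * B * cO N B E g k := sS
          _ ≤ (τ * n) * ((n : ℝ) ^ (k + 1) * (τ ^ k * k * κ * r))
              + 2 * (τ * n) * B * ((m + 1) * (n : ℝ) ^ k * r) := by
            rw [hN]; gcongr
          _ = (n : ℝ) ^ (k + 2) * (τ ^ (k + 1) * k * κ * r)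
              + τ * (n : ℝ) ^ (k + 1) * r * (2 * B * (m + 1)) := by ring
          _ = (n : ℝ) ^ (k + 2) * (τ ^ (k + 1) * k * κ * r)
              + (n : ℝ) ^ (k + 2) * (τ * κ * r) := by rw [← hκn]; ring
          _ ≤ (n : ℝ) ^ (k + 2) * (τ ^ (k + 1) * k * κ * r)
              + (n : ℝ) ^ (k + 2) * (τ ^ (k + 1) * κ * r) := by gcongr
          _ = _ := by ring
      have hle : τ ^ (k + 1) * (k + 1) * κ ≤ ρ := by
        rw [hρ]
        have : ((k : ℝ) + 1) ≤ m := by exact_mod_cast hk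
        gcongr
      refine ⟨?_, ?_, ?_⟩
      · calc (cT N B E (k + 1) : ℝ) ≤ n * cT N B E k + cS N B E (k + 1) := sT
          _ ≤ n * ((n : ℝ) ^ (k + 1) * r) + (n : ℝ) ^ (k + 2) * (ρ * r) := by
            have : (n : ℝ) ^ (k + 2) * (τ ^ (k + 1) * (k + 1) * κ * r) ≤ (n : ℝ) ^ (k + 2) * (ρ * r) := by
              gcongr
            have : (n : ℝ) * cT N B E k ≤ n * ((n : ℝ) ^ (k + 1) * r) := by gcongr
            linarith
          _ = _ := by rw [hr]; ring
      · refine bS.trans ?_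
        push_cast
        gcongr
      · calc (cO N B E g (k + 1) : ℝ) ≤ (m + 1) * cT N B E k := sO
          _ ≤ (m + 1) * ((n : ℝ) ^ (k + 1) * r) := by gcongr
          _ ≤ (m + 1) * ((n : ℝ) ^ (k + 1) * (1 + ρ) ^ (k + 1)) := by gcongr
          _ = _ := by ring
  exact (main m le_rfl).1

end counting

section kernel

/-- The explicit (sub-)eigenfunction. -/
noncomputable def ff (σ θ y : ℝ) : ℝ := Real.exp (σ * y) * Real.sin (θ * y)

noncomputable def kΦ (σ θ lam Y y : ℝ) : ℝ≥0∞ :=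
  if lam ≤ y ∧ y ≤ Y then ENNReal.ofReal (ff σ θ (min y (Y - lam)) / ff σ θ lam) else 0

noncomputable def kD (μ : Measure ℝ) (σ θ lam Y y : ℝ) : ℝ≥0∞ :=
  ∫⁻ t, kΦ σ θ lam Y (y + lam - t) ∂μ

lemma continuous_ff (σ θ : ℝ) : Continuous (ff σ θ) := by
  unfold ff; fun_prop

lemma measurable_kΦ (σ θ lam Y : ℝ) : Measurable (kΦ σ θ lam Y) := by
  unfold kΦ
  refine Measurable.ite ?_ ?_ measurable_const
  · exact measurableSet_Icc
  · refine ENNReal.measurable_ofReal.comp ?_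
    refine Measurable.div_const ?_ _
    exact (continuous_ff σ θ).measurable.comp (measurable_id.min measurable_const)

variable {σ θ lam Y : ℝ}

lemma ff_deriv (hs : Real.exp (σ * lam) * Real.cos (θ * lam) = σ)
    (hc : Real.exp (σ * lam) * Real.sin (θ * lam) = θ) (y : ℝ) :
    HasDerivAt (ff σ θ) (ff σ θ (y + lam)) y := by
  have h1 : HasDerivAt (fun y => Real.exp (σ * y)) (Real.exp (σ * y) * (σ * 1)) y :=
    ((hasDerivAt_id y).const_mul σ).exp
  have h2 : HasDerivAt (fun y => Real.sin (θ * y)) (Real.cos (θ * y) * (θ * 1)) y :=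
    ((hasDerivAt_id y).const_mul θ).sin
  have h3 : HasDerivAt (ff σ θ) _ y := h1.mul h2
  refine h3.congr_deriv ?_
  unfold ff
  rw [mul_add, mul_add, Real.exp_add, Real.sin_add]
  linear_combination -(Real.exp (σ * y) * Real.sin (θ * y)) * hs
    - (Real.exp (σ * y) * Real.cos (θ * y)) * hc

lemma ker_exists (n : ℕ) (hn : 0 < n) (hs : Real.exp (σ * lam) * Real.cos (θ * lam) = σ)
    (hc : Real.exp (σ * lam) * Real.sin (θ * lam) = θ) (hlam : 0 < lam) (hθ : 0 < θ) (hσ : 0 ≤ σ)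
    (hY : θ * Y = Real.pi) (h2 : θ * lam ≤ Real.pi / 2)  (N B : ℝ≥0)
    (hN : (N : ℝ) = Real.exp (Y / n) * n) (hB : (B : ℝ) = Real.exp (σ * Y)) :
    Ker (expMeasure ((n : ℝ)⁻¹)) lam (kΦ σ θ lam Y) (kD (expMeasure ((n : ℝ)⁻¹)) σ θ lam Y) N B := by
  have hpi := Real.pi_pos
  have hn' : (0 : ℝ) < n := by exact_mod_cast hn
  have hY0 : 0 < Y := by
    by_contra h
    push Not at h
    nlinarith
  have hlY : lam ≤ Y - lam := by
    by_contra h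
    push Not at h
    nlinarith
  have hd := ff_deriv hs hc
  have hmono : MonotoneOn (ff σ θ) (Set.Icc 0 (Y - lam)) := by
    refine monotoneOn_of_deriv_nonneg (convex_Icc _ _) (continuous_ff σ θ).continuousOn
      (fun y _ => (hd y).differentiableAt.differentiableWithinAt) ?_
    intro y hy
    rw [interior_Icc] at hy
    rw [(hd y).deriv]
    refine mul_nonneg (Real.exp_pos _).le (Real.sin_nonneg_of_nonneg_of_le_pi ?_ ?_)
    · have := hy.1; positivity
    · rw [← hY]; gcongr; linarith [hy.2]
  have hanti : AntitoneOn (ff σ θ) (Set.Icc (Y - lam) Y) := by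
    refine antitoneOn_of_deriv_nonpos (convex_Icc _ _) (continuous_ff σ θ).continuousOn
      (fun y _ => (hd y).differentiableAt.differentiableWithinAt) ?_
    intro y hy
    rw [interior_Icc] at hy
    rw [(hd y).deriv]
    have : 0 ≤ Real.sin (θ * (y + lam) - Real.pi) := by
      refine Real.sin_nonneg_of_nonneg_of_le_pi ?_ ?_
      · rw [← hY]; nlinarith [hy.1]
      · have : θ * (y + lam) ≤ θ * (Y + lam) := by gcongr; exact hy.2.le
        nlinarith
    rw [Real.sin_sub_pi] at this
    unfold ff
    nlinarith [Real.exp_pos (σ * (y + lam))]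
  have hfl : 0 < ff σ θ lam := by
    unfold ff; rw [hc]; exact hθ
  have hf0 : ff σ θ 0 = 0 := by simp [ff]
  have hmid : ff σ θ (Y - lam) = Real.exp (σ * (Y - lam)) * Real.sin (θ * lam) := by
    unfold ff
    rw [mul_sub θ, hY, Real.sin_pi_sub]
  have hratio : ff σ θ (Y - lam) / ff σ θ lam ≤ Real.exp (σ * Y) := by
    rw [div_le_iff₀ hfl, hmid]
    have hsin : 0 ≤ Real.sin (θ * lam) :=
      Real.sin_nonneg_of_nonneg_of_le_pi (by positivity) (by linarith)
    unfold ff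
    rw [← mul_assoc, ← Real.exp_add]
    gcongr
    nlinarith
  refine ⟨measurable_kΦ _ _ _ _, ?_, fun y => rfl, ?_, ?_, ?_, ?_⟩
  · have hpr : IsProbabilityMeasure (expMeasure ((n : ℝ)⁻¹)) :=
      isProbabilityMeasure_expMeasure (by positivity)
    unfold kD
    refine Measurable.lintegral_prod_right' (f := fun p : ℝ × ℝ => kΦ σ θ lam Y (p.1 + lam - p.2)) ?_
    exact (measurable_kΦ _ _ _ _).comp (by fun_prop)
  · intro y
    by_cases hy : lam ≤ y ∧ y ≤ Y
    swap
    · simp [kΦ, hy]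
    obtain ⟨hy1, hy2⟩ := hy
    set m := min y (Y - lam) with hm
    have hm1 : lam ≤ m := le_min hy1 hlY
    have hm2 : m ≤ y := min_le_left _ _
    have hm3 : m ≤ Y - lam := min_le_right _ _
    have hIntegral : ∫ t in (y - m)..y, ff σ θ (y - t + lam) = ff σ θ m := by
      have := intervalIntegral.integral_eq_sub_of_hasDerivAt (a := y - m) (b := y)
        (f := fun t => - ff σ θ (y - t)) (f' := fun t => ff σ θ (y - t + lam)) ?_ ?_
      · rw [this]; simp [hf0]
      · intro t _
        have h1 : HasDerivAt (fun t => y - t) (-1) t := by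
          simpa using (hasDerivAt_id t).const_sub y
        have h3 : HasDerivAt (fun t => - ff σ θ (y - t)) _ t := ((hd (y - t)).comp t h1).neg
        exact h3.congr_deriv (by ring)
      · apply Continuous.intervalIntegrable
        exact (continuous_ff σ θ).comp (by fun_prop)
    have hpos : ∀ t ∈ Set.Ioc (y - m) y, 0 ≤ ff σ θ (y - t + lam) := by
      intro t ht
      refine mul_nonneg (Real.exp_pos _).le (Real.sin_nonneg_of_nonneg_of_le_pi ?_ ?_)
      · have := ht.2
        have : 0 ≤ y - t + lam := by linarith
        positivity
      · rw [← hY]; gcongr; linarith [ht.1]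
    have hlint : ∫⁻ t in Set.Ioc (y - m) y, ENNReal.ofReal (ff σ θ (y - t + lam))
        = ENNReal.ofReal (ff σ θ m) := by
      rw [← hIntegral, intervalIntegral.integral_of_le (by linarith),
        ofReal_integral_eq_lintegral_ofReal]
      · have : Continuous fun t => ff σ θ (y - t + lam) := (continuous_ff σ θ).comp (by fun_prop)
        exact (this.integrableOn_Icc).mono_set Set.Ioc_subset_Icc_self
      · exact (ae_restrict_iff' measurableSet_Ioc).2 (ae_of_all _ hpos)
    set c : ℝ := (n : ℝ)⁻¹ * Real.exp (-(Y / n)) / ff σ θ lam with hcdef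
    have hc0 : 0 ≤ c := by positivity
    have hDlow : ENNReal.ofReal c * ENNReal.ofReal (ff σ θ m)
        ≤ kD (expMeasure ((n : ℝ)⁻¹)) σ θ lam Y y := by
      have hme : Measurable fun t => kΦ σ θ lam Y (y + lam - t) :=
        (measurable_kΦ _ _ _ _).comp (by fun_prop)
      have hpm : Measurable (gammaPDF 1 (n : ℝ)⁻¹) :=
        (measurable_gammaPDFReal 1 _).ennreal_ofReal
      unfold kD expMeasure gammaMeasure
      rw [lintegral_withDensity_eq_lintegral_mul _ hpm hme, ← hlint,
        ← lintegral_const_mul' _ _ ENNReal.ofReal_ne_top]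
      refine le_trans ?_ (setLIntegral_le_lintegral (Set.Ioc (y - m) y) _)
      refine setLIntegral_mono' measurableSet_Ioc fun t ht => ?_
      have ht0 : 0 ≤ t := by linarith [ht.1]
      simp only [Pi.mul_apply]
      have e1 : gammaPDF 1 (n : ℝ)⁻¹ t = ENNReal.ofReal ((n : ℝ)⁻¹ * Real.exp (-((n : ℝ)⁻¹ * t))) := by
        simp [gammaPDF, gammaPDFReal, ht0]
      have hz1 : lam ≤ y + lam - t := by linarith [ht.2]
      have hz2 : y + lam - t ≤ Y := by linarith [ht.1]
      have e2 : ENNReal.ofReal (ff σ θ (y - t + lam) / ff σ θ lam) ≤ kΦ σ θ lam Y (y + lam - t) := by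
        unfold kΦ
        rw [if_pos ⟨hz1, hz2⟩]
        refine ENNReal.ofReal_le_ofReal ?_
        gcongr
        rw [show y - t + lam = y + lam - t by ring]
        rcases le_total (y + lam - t) (Y - lam) with h | h
        · rw [min_eq_left h]
        · rw [min_eq_right h]
          exact hanti ⟨le_rfl, by linarith⟩ ⟨h, hz2⟩ h
      rw [e1]
      calc _ = ENNReal.ofReal ((n : ℝ)⁻¹ * Real.exp (-(Y / n))) *
            ENNReal.ofReal (ff σ θ (y - t + lam) / ff σ θ lam) := by
            rw [← ENNReal.ofReal_mul hc0, ← ENNReal.ofReal_mul (by positivity)]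
            congr 1
            rw [hcdef]; ring
        _ ≤ _ := by
            gcongr
            rw [inv_mul_eq_div]
            have : t ≤ Y := ht.2.trans hy2
            gcongr
    calc kΦ σ θ lam Y y = ENNReal.ofReal (ff σ θ m / ff σ θ lam) := by
          simp [kΦ, hy1, hy2, hm]
      _ = N * (ENNReal.ofReal c * ENNReal.ofReal (ff σ θ m)) := by
          rw [← ENNReal.ofReal_coe_nnreal, ← ENNReal.ofReal_mul hc0, ← ENNReal.ofReal_mul (NNReal.coe_nonneg N), hN, hcdef]
          congr 1
          rw [Real.exp_neg]
          field_simp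
      _ ≤ _ := by gcongr
  · intro y
    unfold kΦ
    split_ifs with hy
    · rw [← ENNReal.ofReal_coe_nnreal, hB]
      refine ENNReal.ofReal_le_ofReal (le_trans ?_ hratio)
      gcongr
      refine hmono ⟨le_min (by linarith) (by linarith), min_le_right _ _⟩ ⟨by linarith, le_rfl⟩ (min_le_right _ _)
    · simp
  · intro y hy
    unfold kΦ at hy ⊢
    split_ifs at hy ⊢ with h
    · rw [ENNReal.one_le_ofReal, le_div_iff₀ hfl, one_mul]
      exact hmono ⟨by linarith, hlY⟩ ⟨le_min (by linarith) (by linarith), min_le_right _ _⟩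
        (le_min h.1 hlY)
    · simp at hy
  · unfold kΦ
    rw [if_pos ⟨le_rfl, by linarith⟩, min_eq_left hlY, div_self hfl.ne', ENNReal.ofReal_one]

end kernel

section second
variable {n : ℕ}

lemma sum_eq_lS (ω : Sym2 (Fin n) → ℝ) (m : ℕ) (v : Fin (m + 1) → Fin n) :
    ∑ i : Fin m, ω s(v i.castSucc, v i.succ) = lS ω (List.ofFn v) := by
  induction m with
  | zero => simp [lS]
  | succ m ih =>
    rw [Fin.sum_univ_succ]
    have := ih (fun i => v i.succ)
    rw [List.ofFn_succ, List.ofFn_succ]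
    rw [List.ofFn_succ] at this
    simp only [lS]
    rw [← this]
    rfl

lemma weight_eq (ω : Sym2 (Fin n) → ℝ) {m : ℕ} (γ : Path n m) :
    weight ω γ = lS ω (List.ofFn γ.1) := sum_eq_lS ω m γ.1

lemma card_path (n m : ℕ) : Fintype.card (Path n m) = n.descFactorial (m + 1) := by
  have e : Path n m ≃ (Fin (m + 1) ↪ Fin n) := Equiv.subtypeInjectiveEquivEmbedding _ _
  rw [Fintype.card_congr e, Fintype.card_embedding_eq]
  simp

lemma cs_lintegral {Ω : Type*} [MeasurableSpace Ω] (ν : Measure Ω) (X : Ω → ℝ≥0∞)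
    (hX : Measurable X) :
    (∫⁻ ω, X ω ∂ν) ^ 2 ≤ (∫⁻ ω, X ω * X ω ∂ν) * ν {ω | X ω ≠ 0} := by
  have hA : MeasurableSet {ω | X ω ≠ 0} := hX (measurableSet_singleton 0).compl
  have h := ENNReal.lintegral_mul_le_Lp_mul_Lq ν Real.HolderConjugate.two_two hX.aemeasurable
    ((measurable_const (a := (1 : ℝ≥0∞))).indicator hA).aemeasurable
  have e : ∀ ω, (X * {ω | X ω ≠ 0}.indicator fun _ => (1 : ℝ≥0∞)) ω = X ω := by
    intro ω
    by_cases hx : X ω = 0 <;> simp [hx, Set.indicator]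
  simp_rw [e] at h
  have e2 : ∫⁻ ω, ({ω | X ω ≠ 0}.indicator (fun _ => (1 : ℝ≥0∞)) ω) ^ (2 : ℝ) ∂ν = ν {ω | X ω ≠ 0} := by
    rw [← lintegral_indicator_one hA]
    refine lintegral_congr fun ω => ?_
    by_cases hx : X ω = 0 <;> simp [hx, Set.indicator]
  rw [e2] at h
  have e3 : ∀ ω, X ω ^ (2 : ℝ) = X ω * X ω := by
    intro ω
    rw [ENNReal.rpow_two, sq]
  simp_rw [e3] at h
  calc _ ≤ ((∫⁻ ω, X ω * X ω ∂ν) ^ (1 / (2 : ℝ)) * ν {ω | X ω ≠ 0} ^ (1 / (2 : ℝ))) ^ 2 := by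
        gcongr
    _ = _ := by
        rw [mul_pow, ← ENNReal.rpow_two, ← ENNReal.rpow_two, ← ENNReal.rpow_mul, ← ENNReal.rpow_mul]
        norm_num

lemma second_moment {lam : ℝ} {Φ D : ℝ → ℝ≥0∞} {N B : ℝ≥0} (m : ℕ) (hn : 0 < n) (hmn : m + 1 ≤ n)
    (K : Ker (expMeasure ((n : ℝ)⁻¹)) lam Φ D N B)
    (hsupp : ∀ y, Φ y ≠ 0 → lam ≤ y) (τ ρ : ℝ) (hτ : 1 ≤ τ) (hN : (N : ℝ) = τ * n)
    (hρ : ρ = τ ^ m * m * (2 * B * (m + 1) / n)) :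
    ∃ A : Set (Sym2 (Fin n) → ℝ), MeasurableSet A ∧
      (∀ ω ∈ A, ∃ γ : Path n m, weight ω γ ≤ lam * m) ∧
      (n.descFactorial (m + 1) : ℝ≥0∞) ≤ ENNReal.ofReal ((n : ℝ) ^ (m + 1) * (1 + ρ) ^ m) * P n A := by
  classical
  have hpr : IsProbabilityMeasure (expMeasure ((n : ℝ)⁻¹)) :=
    isProbabilityMeasure_expMeasure (by positivity)
  set X : (Sym2 (Fin n) → ℝ) → ℝ≥0∞ := fun ω => ∑ γ : Path n m, lW lam Φ D ω (List.ofFn γ.1) with hX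
  have hXm : Measurable X := Finset.measurable_fun_sum _ fun γ _ => measurable_lW lam Φ D K.mΦ K.mD _
  have hne : ∀ γ : Path n m, List.ofFn γ.1 ≠ [] := fun γ => by simp
  have hnd : ∀ γ : Path n m, (List.ofFn γ.1).Nodup := fun γ => List.nodup_ofFn.2 γ.2
  refine ⟨{ω | X ω ≠ 0}, hXm (measurableSet_singleton 0).compl, ?_, ?_⟩
  · intro ω hω
    obtain ⟨γ, -, hγ⟩ := Finset.exists_ne_zero_of_sum_ne_zero hω
    refine ⟨γ, ?_⟩
    have := hsupp _ (left_ne_zero_of_mul hγ)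
    rw [weight_eq]
    simp only [lY, List.length_ofFn] at this
    push_cast at this
    linarith
  · have h1 : ∫⁻ ω, X ω ∂(P n) = n.descFactorial (m + 1) := by
      rw [hX, lintegral_finsetSum _ fun γ _ => measurable_lW lam Φ D K.mΦ K.mD _]
      unfold P
      simp_rw [fun γ : Path n m => K.mean (List.ofFn γ.1) (hne γ) (hnd γ)]
      rw [Finset.sum_const, ← card_path]
      simp
    have h2 : ∫⁻ ω, X ω * X ω ∂(P n) ≤
        n.descFactorial (m + 1) * ENNReal.ofReal ((n : ℝ) ^ (m + 1) * (1 + ρ) ^ m) := by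
      have : ∀ ω, X ω * X ω = ∑ γ : Path n m, ∑ γ' : Path n m,
          lW lam Φ D ω (List.ofFn γ.1) * lW lam Φ D ω (List.ofFn γ'.1) := by
        intro ω
        rw [hX, Finset.sum_mul_sum]
      simp_rw [this]
      have hmW : ∀ γ γ' : Path n m, Measurable fun ω =>
          lW lam Φ D ω (List.ofFn γ.1) * lW lam Φ D ω (List.ofFn γ'.1) := fun γ γ' =>
        (measurable_lW lam Φ D K.mΦ K.mD _).mul (measurable_lW lam Φ D K.mΦ K.mD _)
      rw [lintegral_finsetSum _ fun γ _ => Finset.measurable_fun_sum _ fun γ' _ => hmW γ γ']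
      rw [← card_path, ← nsmul_eq_mul, ← Finset.card_univ]
      refine Finset.sum_le_card_nsmul _ _ _ fun γ _ => ?_
      rw [lintegral_finsetSum _ fun γ' _ => hmW γ γ']
      calc _ ≤ ∑ γ' : Path n m, (mm N B {e | e ∈ lE (List.ofFn γ.1)} (List.ofFn γ'.1) : ℝ≥0∞) := by
            refine Finset.sum_le_sum fun γ' _ => ?_
            rw [mm, if_pos (hnd γ')]
            exact (K.pair _ (hne γ) (hnd γ) _ (hne γ') (hnd γ')).1
        _ ≤ (cT N B {e | e ∈ lE (List.ofFn γ.1)} m : ℝ≥0∞) := by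
            rw [← ENNReal.ofNNReal_finsetSum]
            norm_cast
            unfold cT
            rw [← Finset.sum_subtype (univ.filter fun v : Fin (m + 1) → Fin n => Function.Injective v)
              (by simp) (fun v => mm N B {e | e ∈ lE (List.ofFn γ.1)} (List.ofFn v))]
            exact Finset.sum_le_sum_of_subset (Finset.filter_subset _ _)
        _ ≤ _ := by
            rw [← ENNReal.ofReal_coe_nnreal]
            refine ENNReal.ofReal_le_ofReal ?_
            exact cT_bound hn _ (hnd γ) m (by simp) τ ρ hτ hN hρ
    have h3 := cs_lintegral (P n) X hXm
    rw [h1] at h3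
    set c : ℝ≥0∞ := (n.descFactorial (m + 1) : ℝ≥0∞) with hc
    have hc0 : c ≠ 0 := by
      rw [hc]; norm_cast
      exact (Nat.descFactorial_pos.2 hmn).ne'
    have hct : c ≠ ⊤ := ENNReal.natCast_ne_top _
    have h4 : c * c ≤ c * (ENNReal.ofReal ((n : ℝ) ^ (m + 1) * (1 + ρ) ^ m) * P n {ω | X ω ≠ 0}) := by
      rw [← sq]
      refine h3.trans ?_
      rw [← mul_assoc]
      gcongr
    exact (ENNReal.mul_le_mul_iff_right hc0 hct).1 h4

end second

section lower

lemma param (α : ℝ) (h0 : 0 < α) (h1 : α ≤ 1) : ∃ σ θ lam Y : ℝ,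
    Real.exp (σ * lam) * Real.cos (θ * lam) = σ ∧ Real.exp (σ * lam) * Real.sin (θ * lam) = θ ∧
    0 < lam ∧ 0 < θ ∧ 0 ≤ σ ∧ θ * Y = Real.pi ∧ θ * lam ≤ Real.pi / 2 ∧
    lam ≤ Real.exp (-1) + 2 * α ^ 2 ∧ σ * Y ≤ Real.pi / α ∧ Y ≤ 2 * Real.pi / α := by
  have hpi := Real.pi_gt_three
  have hsin : 0 < Real.sin α := Real.sin_pos_of_pos_of_lt_pi h0 (by linarith)
  have hcos : 0 < Real.cos α := Real.cos_pos_of_mem_Ioo ⟨by linarith, by linarith⟩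
  set c : ℝ := α * Real.cos α / Real.sin α with hc
  have hc0 : 0 ≤ c := by positivity
  set θ := Real.sin α * Real.exp c with hθ
  set σ := Real.cos α * Real.exp c with hσ
  have hθ0 : 0 < θ := by positivity
  have e1 : θ * (α / θ) = α := by field_simp
  have e2 : σ * (α / θ) = c := by
    rw [hσ, hθ, hc]; field_simp
  have hsin1 : α - α ^ 3 / 4 < Real.sin α := by
    have h := Real.sin_gt_sub_cube h0
    have h' : 0 < α ^ 3 := by positivity
    linarith
  have hsin2 : Real.sin α < α := Real.sin_lt h0
  have hcos1 : 1 - α ^ 2 / 2 ≤ Real.cos α := Real.one_sub_sq_div_two_le_cos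
  have hsinhalf : α / 2 ≤ Real.sin α := by
    have : α ^ 3 ≤ α := by
      calc α ^ 3 ≤ α ^ 1 := pow_le_pow_of_le_one h0.le h1 (by norm_num)
        _ = α := pow_one α
    linarith
  refine ⟨σ, θ, α / θ, Real.pi / θ, ?_, ?_, by positivity, hθ0, by positivity, by field_simp, ?_, ?_, ?_, ?_⟩
  · rw [e1, e2, hσ]; ring
  · rw [e1, e2, hθ]; ring
  · rw [e1]; linarith
  · have hca : 1 - α ^ 2 / 2 ≤ c := by
      refine hcos1.trans ?_
      rw [hc, le_div_iff₀ hsin]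
      nlinarith
    have hu : α ^ 2 ≤ 1 := by nlinarith
    have hE : Real.exp (-c) ≤ Real.exp (-1) * (1 + α ^ 2) := by
      calc Real.exp (-c) ≤ Real.exp (-1 + α ^ 2 / 2) := by
            apply Real.exp_le_exp.2; linarith
        _ = Real.exp (-1) * Real.exp (α ^ 2 / 2) := Real.exp_add _ _
        _ ≤ _ := by
            gcongr
            have h := Real.add_one_le_exp (-(α ^ 2 / 2))
            rw [Real.exp_neg] at h
            have hp := Real.exp_pos (α ^ 2 / 2)
            have h3 : (-(α ^ 2 / 2) + 1) * Real.exp (α ^ 2 / 2) ≤ 1 := by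
              calc _ ≤ (Real.exp (α ^ 2 / 2))⁻¹ * Real.exp (α ^ 2 / 2) := by gcongr
                _ = 1 := inv_mul_cancel₀ hp.ne'
            have h4 : 1 ≤ (-(α ^ 2 / 2) + 1) * (1 + α ^ 2) := by nlinarith [sq_nonneg α]
            have h5 : 0 < -(α ^ 2 / 2) + 1 := by linarith
            nlinarith
    have hS : α / Real.sin α ≤ 1 + α ^ 2 / 2 := by
      rw [div_le_iff₀ hsin]
      have : (1 + α ^ 2 / 2) * (α - α ^ 3 / 4) ≤ (1 + α ^ 2 / 2) * Real.sin α := by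
        gcongr
      have h6 : α ≤ (1 + α ^ 2 / 2) * (α - α ^ 3 / 4) := by
        have : (1 + α ^ 2 / 2) * (α - α ^ 3 / 4) - α = α ^ 3 / 4 * (1 - α ^ 2 / 2) := by ring
        have h7 : 0 ≤ α ^ 3 / 4 * (1 - α ^ 2 / 2) := by
          apply mul_nonneg
          · positivity
          · linarith
        linarith
      linarith
    have hl : α / θ = α / Real.sin α * Real.exp (-c) := by
      rw [hθ, Real.exp_neg]; field_simp
    have he1 : Real.exp (-1) ≤ 1 := Real.exp_le_one_iff.2 (by norm_num)
    have he0 := Real.exp_pos (-1)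
    calc α / θ ≤ (1 + α ^ 2 / 2) * (Real.exp (-1) * (1 + α ^ 2)) := by
          rw [hl]; gcongr
      _ = Real.exp (-1) + Real.exp (-1) * (α ^ 2 * (3 / 2 + α ^ 2 / 2)) := by ring
      _ ≤ Real.exp (-1) + 1 * (α ^ 2 * (3 / 2 + 1 / 2)) := by gcongr
      _ = _ := by ring
  · have : σ * (Real.pi / θ) = Real.pi * (Real.cos α / Real.sin α) := by
      rw [hσ, hθ]; field_simp
    rw [this, div_eq_mul_inv Real.pi α]
    gcongr
    rw [div_le_iff₀ hsin, inv_mul_eq_div, le_div_iff₀ h0]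
    have := Real.le_tan h0.le (by linarith)
    rw [Real.tan_eq_sin_div_cos, le_div_iff₀ hcos] at this
    linarith
  · have : α / 2 ≤ θ := by
      refine hsinhalf.trans ?_
      rw [hθ]
      have := Real.one_le_exp hc0
      nlinarith
    calc Real.pi / θ ≤ Real.pi / (α / 2) := by gcongr
      _ = _ := by field_simp

lemma lower_n (n m : ℕ) (α ρ : ℝ) (hn : 0 < n) (hmn : m + 1 ≤ n) (h0 : 0 < α) (h1 : α ≤ 1)
    (hρ : Real.exp (2 * Real.pi / α / n) ^ m * m * (2 * Real.exp (Real.pi / α) * (m + 1) / n) ≤ ρ) :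
    ∃ A : Set (Sym2 (Fin n) → ℝ), MeasurableSet A ∧
      (∀ ω ∈ A, ∃ γ : Path n m, weight ω γ ≤ (Real.exp (-1) + 2 * α ^ 2) * m) ∧
      (n.descFactorial (m + 1) : ℝ≥0∞) ≤ ENNReal.ofReal ((n : ℝ) ^ (m + 1) * (1 + ρ) ^ m) * P n A := by
  obtain ⟨σ, θ, lam, Y, hs, hc, hlam, hθ, hσ, hY, h2, hl, hB, hYb⟩ := param α h0 h1
  have hY0 : 0 < Y := by
    by_contra h
    push Not at h
    nlinarith [Real.pi_pos]
  obtain ⟨N, hN⟩ : ∃ N : ℝ≥0, (N : ℝ) = Real.exp (Y / n) * n :=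
    ⟨⟨Real.exp (Y / n) * n, by positivity⟩, rfl⟩
  obtain ⟨B, hBB⟩ : ∃ B : ℝ≥0, (B : ℝ) = Real.exp (σ * Y) :=
    ⟨⟨Real.exp (σ * Y), by positivity⟩, rfl⟩
  have K := ker_exists (N := N) (B := B) n hn hs hc hlam hθ hσ hY h2 hN hBB
  obtain ⟨A, hA, hA1, hA2⟩ := second_moment m hn hmn K (by
    intro y hy
    unfold kΦ at hy
    split_ifs at hy with h
    · exact h.1
    · simp at hy) (Real.exp (Y / n)) _ (Real.one_le_exp (by positivity)) hN rfl
  refine ⟨A, hA, ?_, hA2.trans ?_⟩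
  · intro ω hω
    obtain ⟨γ, hγ⟩ := hA1 ω hω
    exact ⟨γ, hγ.trans (by gcongr)⟩
  · gcongr
    refine le_trans ?_ hρ
    rw [hBB]
    gcongr

lemma lower_real (n m : ℕ) (ρ p : ℝ) (hn : 0 < n) (hmn : m + 1 ≤ n) (hρ0 : 0 ≤ ρ)
    (h : (n.descFactorial (m + 1) : ℝ) ≤ (n : ℝ) ^ (m + 1) * (1 + ρ) ^ m * p) (hp : 0 ≤ p) :
    (1 - (m + 1) * m / n) * Real.exp (-(ρ * m)) ≤ p := by
  have hn' : (0 : ℝ) < n := by exact_mod_cast hn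
  have h1 : ((n : ℝ) - m) ^ (m + 1) ≤ (n.descFactorial (m + 1) : ℝ) := by
    have := Nat.pow_sub_le_descFactorial n (m + 1)
    have h2 : n + 1 - (m + 1) = n - m := by omega
    rw [h2] at this
    have h3 : ((n - m : ℕ) : ℝ) ^ (m + 1) ≤ (n.descFactorial (m + 1) : ℝ) := by exact_mod_cast this
    rwa [Nat.cast_sub (by omega)] at h3
  have h2 : (1 - (m + 1) * m / n : ℝ) ≤ (((n : ℝ) - m) / n) ^ (m + 1) := by
    have hmn' : (m : ℝ) ≤ n := by exact_mod_cast (by omega : m ≤ n)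
    have hb : (m : ℝ) / n ≤ 1 := by rw [div_le_one hn']; exact hmn'
    have := one_add_mul_le_pow (a := -((m : ℝ) / n)) (by linarith) (m + 1)
    calc (1 - (m + 1) * m / n : ℝ) = 1 + ((m + 1 : ℕ) : ℝ) * -((m : ℝ) / n) := by push_cast; ring
      _ ≤ (1 + -((m : ℝ) / n)) ^ (m + 1) := this
      _ = _ := by congr 1; field_simp; ring
  have h3 : (1 + ρ) ^ m ≤ Real.exp (ρ * m) := by
    rw [mul_comm, Real.exp_nat_mul]
    gcongr
    linarith [Real.add_one_le_exp ρ]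
  have h4 : (((n : ℝ) - m) / n) ^ (m + 1) ≤ Real.exp (ρ * m) * p := by
    rw [div_pow, div_le_iff₀ (by positivity)]
    calc _ ≤ _ := h1
      _ ≤ _ := h
      _ ≤ (n : ℝ) ^ (m + 1) * Real.exp (ρ * m) * p := by gcongr
      _ = _ := by ring
  calc _ ≤ (Real.exp (ρ * m) * p) * Real.exp (-(ρ * m)) := by gcongr; exact h2.trans h4
    _ = p := by rw [Real.exp_neg]; field_simp

end lower

section lowerlim

lemma P_prob (n : ℕ) (hn : 0 < n) : IsProbabilityMeasure (P n) := by
  have hn' : (0 : ℝ) < n := by exact_mod_cast hn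
  have : IsProbabilityMeasure (expMeasure ((n : ℝ)⁻¹)) :=
    isProbabilityMeasure_expMeasure (by positivity)
  unfold P
  infer_instance

lemma tendsto_u : Tendsto (fun n : ℕ => Real.exp (Real.log n / 8)) atTop atTop := by
  refine Real.tendsto_exp_atTop.comp ?_
  exact (Real.tendsto_log_atTop.comp tendsto_natCast_atTop_atTop).atTop_div_const (by norm_num)

lemma lower_u (n : ℕ) (u : ℝ) (hu : u = Real.exp (Real.log n / 8)) (hu2 : 2 ≤ u) (hn : 0 < n)
    (hlog : 8 * Real.pi ≤ Real.log n) :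
    ∃ A : Set (Sym2 (Fin n) → ℝ), MeasurableSet A ∧
      (∀ ω ∈ A, ∃ m : ℕ, (n : ℝ) ^ ((1 : ℝ) / 4) ≤ m ∧ ∃ γ : Path n m,
        weight ω γ ≤ (Real.exp (-1) + 128 * Real.pi ^ 2 * ((Real.log n) ^ 2)⁻¹) * m) ∧
      ENNReal.ofReal ((1 - 6 / u ^ 4) * Real.exp (-(72 / u))) ≤ P n A := by
  have hpi := Real.pi_pos
  have hn' : (0 : ℝ) < n := by exact_mod_cast hn
  have hl0 : 0 < Real.log n := by linarith
  have hn8 : (n : ℝ) = u ^ 8 := by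
    rw [hu, ← Real.exp_nat_mul]
    push_cast
    rw [mul_div_cancel₀ _ (by norm_num : (8 : ℝ) ≠ 0), Real.exp_log hn']
  have hn4 : (n : ℝ) ^ ((1 : ℝ) / 4) = u ^ 2 := by
    rw [Real.rpow_def_of_pos hn', hu, ← Real.exp_nat_mul]
    congr 1
    push_cast
    ring
  have hul : Real.log n ≤ 8 * u := by
    have := Real.add_one_le_exp (Real.log n / 8)
    rw [← hu] at this
    linarith
  have hu1 : (1 : ℝ) ≤ u ^ 2 := by nlinarith
  have hu6 : (64 : ℝ) ≤ u ^ 6 := by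
    calc (64 : ℝ) = 2 ^ 6 := by norm_num
      _ ≤ u ^ 6 := by gcongr
  have hu5 : (32 : ℝ) ≤ u ^ 5 := by
    calc (32 : ℝ) = 2 ^ 5 := by norm_num
      _ ≤ u ^ 5 := by gcongr
  have hu4 : (16 : ℝ) ≤ u ^ 4 := by
    calc (16 : ℝ) = 2 ^ 4 := by norm_num
      _ ≤ u ^ 4 := by gcongr
  obtain ⟨m, hm⟩ : ∃ m : ℕ, m = ⌈u ^ 2⌉₊ := ⟨_, rfl⟩
  have hm1 : u ^ 2 ≤ m := by rw [hm]; exact Nat.le_ceil _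
  have hm2 : (m : ℝ) ≤ 2 * u ^ 2 := by
    have := Nat.ceil_lt_add_one (by positivity : (0 : ℝ) ≤ u ^ 2)
    rw [← hm] at this
    linarith
  have hm3 : (m : ℝ) + 1 ≤ 3 * u ^ 2 := by linarith
  have hmn : m + 1 ≤ n := by
    have : ((m : ℝ) + 1) ≤ n := by
      rw [hn8]
      nlinarith
    exact_mod_cast this
  set α := 8 * Real.pi / Real.log n with hα
  have hα0 : 0 < α := by positivity
  have hα1 : α ≤ 1 := by rw [hα, div_le_one hl0]; exact hlog
  have e1 : Real.pi / α = Real.log n / 8 := by rw [hα]; field_simp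
  have e2 : 2 * Real.pi / α = Real.log n / 4 := by rw [hα]; field_simp; norm_num
  have e3 : 2 * α ^ 2 = 128 * Real.pi ^ 2 * ((Real.log n) ^ 2)⁻¹ := by
    rw [hα]; field_simp; norm_num
  have hu0 : 0 < u := by linarith
  have hρ : Real.exp (2 * Real.pi / α / n) ^ m * m * (2 * Real.exp (Real.pi / α) * (m + 1) / n)
      ≤ 36 / u ^ 3 := by
    have hE : Real.exp (2 * Real.pi / α / n) ^ m ≤ 3 := by
      rw [← Real.exp_nat_mul, e2]
      refine le_trans (Real.exp_le_exp.2 (?_ : _ ≤ (1 : ℝ))) (by linarith [Real.exp_one_lt_d9])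
      calc (m : ℝ) * (Real.log n / 4 / n) ≤ (2 * u ^ 2) * (8 * u / 4 / n) := by gcongr
        _ = 4 / u ^ 5 := by rw [hn8]; field_simp; norm_num
        _ ≤ 1 := by rw [div_le_one (by positivity)]; linarith
    rw [e1, ← hu]
    calc _ ≤ 3 * (2 * u ^ 2) * (2 * u * (3 * u ^ 2) / n) := by gcongr
      _ = 36 / u ^ 3 := by rw [hn8]; field_simp; norm_num
  obtain ⟨A, hA, hA1, hA2⟩ := lower_n n m α (36 / u ^ 3) hn hmn hα0 hα1 hρ
  refine ⟨A, hA, ?_, ?_⟩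
  · intro ω hω
    obtain ⟨γ, hγ⟩ := hA1 ω hω
    refine ⟨m, by rw [hn4]; exact hm1, γ, ?_⟩
    rw [← e3]; exact hγ
  · have := P_prob n hn
    have hr : (n.descFactorial (m + 1) : ℝ)
        ≤ (n : ℝ) ^ (m + 1) * (1 + 36 / u ^ 3) ^ m * (P n A).toReal := by
      have h3 := ENNReal.toReal_mono (by finiteness) hA2
      rw [ENNReal.toReal_mul, ENNReal.toReal_ofReal (by positivity), ENNReal.toReal_natCast] at h3
      exact h3
    have h4 := lower_real n m _ _ hn hmn (by positivity) hr ENNReal.toReal_nonneg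
    refine ENNReal.ofReal_le_of_le_toReal (le_trans ?_ h4)
    have h5 : 36 / u ^ 3 * (m : ℝ) ≤ 72 / u := by
      calc 36 / u ^ 3 * (m : ℝ) ≤ 36 / u ^ 3 * (2 * u ^ 2) := by gcongr
        _ = 72 / u := by field_simp; norm_num
    have h6 : ((m : ℝ) + 1) * m / n ≤ 6 / u ^ 4 := by
      calc ((m : ℝ) + 1) * m / n ≤ (3 * u ^ 2) * (2 * u ^ 2) / n := by gcongr
        _ = 6 / u ^ 4 := by rw [hn8]; field_simp; norm_num
    have h7 : 6 / u ^ 4 ≤ 1 := by rw [div_le_one (by positivity)]; linarith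
    have h8 : Real.exp (-(72 / u)) ≤ Real.exp (-(36 / u ^ 3 * m)) := by
      apply Real.exp_le_exp.2; linarith
    apply mul_le_mul (by linarith) h8 (Real.exp_pos _).le (by linarith)

lemma lower_lim : ∃ a : ℕ → ℝ, Tendsto a atTop (nhds 1) ∧ ∀ᶠ n : ℕ in atTop,
    ∃ A : Set (Sym2 (Fin n) → ℝ), MeasurableSet A ∧
      (∀ ω ∈ A, ∃ m : ℕ, (n : ℝ) ^ ((1 : ℝ) / 4) ≤ m ∧ ∃ γ : Path n m,
        weight ω γ ≤ (Real.exp (-1) + 128 * Real.pi ^ 2 * ((Real.log n) ^ 2)⁻¹) * m) ∧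
      ENNReal.ofReal (a n) ≤ P n A := by
  refine ⟨fun n => (1 - 6 / Real.exp (Real.log n / 8) ^ 4) *
    Real.exp (-(72 / Real.exp (Real.log n / 8))), ?_, ?_⟩
  · have h1 : Tendsto (fun n : ℕ => 6 / Real.exp (Real.log n / 8) ^ 4) atTop (nhds 0) :=
      Tendsto.const_div_atTop ((tendsto_pow_atTop (by norm_num)).comp tendsto_u) _
    have h2 : Tendsto (fun n : ℕ => 72 / Real.exp (Real.log n / 8)) atTop (nhds 0) :=
      tendsto_u.const_div_atTop _
    have h3 := (h1.const_sub 1).mul ((Real.continuous_exp.tendsto _).comp h2.neg)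
    simpa using h3
  · have hlog : Tendsto (fun n : ℕ => Real.log n) atTop atTop :=
      Real.tendsto_log_atTop.comp tendsto_natCast_atTop_atTop
    filter_upwards [tendsto_u.eventually_ge_atTop 2, hlog.eventually_ge_atTop (8 * Real.pi),
      eventually_gt_atTop 0] with n h1 h2 h3
    exact lower_u n _ rfl h1 h3 h2

end lowerlim

section upper

lemma exp_mgf (n : ℕ) (hn : 0 < n) (s : ℝ) (hs : 0 < s) :
    ∫⁻ t, ENNReal.ofReal (Real.exp (-(s * t))) ∂(expMeasure ((n : ℝ)⁻¹))
      ≤ ENNReal.ofReal (1 / (n * s)) := by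
  have hn' : (0 : ℝ) < n := by exact_mod_cast hn
  have hme : Measurable fun t : ℝ => ENNReal.ofReal (Real.exp (-(s * t))) := by fun_prop
  have hpm : Measurable (gammaPDF 1 (n : ℝ)⁻¹) :=
    (measurable_gammaPDFReal 1 _).ennreal_ofReal
  unfold expMeasure gammaMeasure
  rw [lintegral_withDensity_eq_lintegral_mul _ hpm hme]
  have hle : ∀ t, (gammaPDF 1 (n : ℝ)⁻¹ * fun t : ℝ => ENNReal.ofReal (Real.exp (-(s * t)))) t
      ≤ ENNReal.ofReal (1 / (n * s)) * gammaPDF 1 s t := by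
    intro t
    simp only [Pi.mul_apply, gammaPDF, gammaPDFReal]
    split_ifs with ht
    · rw [← ENNReal.ofReal_mul (by positivity), ← ENNReal.ofReal_mul (by positivity)]
      apply ENNReal.ofReal_le_ofReal
      simp only [Real.rpow_one, Real.Gamma_one, sub_self, Real.rpow_zero, div_one, mul_one]
      have h1 : Real.exp (-((n : ℝ)⁻¹ * t)) ≤ 1 := by
        apply Real.exp_le_one_iff.2
        have : 0 ≤ (n : ℝ)⁻¹ * t := by positivity
        linarith
      calc (n : ℝ)⁻¹ * Real.exp (-((n : ℝ)⁻¹ * t)) * Real.exp (-(s * t))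
          ≤ (n : ℝ)⁻¹ * 1 * Real.exp (-(s * t)) := by gcongr
        _ = _ := by field_simp
    · simp
  refine (lintegral_mono hle).trans ?_
  rw [lintegral_const_mul' _ _ ENNReal.ofReal_ne_top, lintegral_gammaPDF_eq_one one_pos hs, mul_one]

lemma chern_list (n : ℕ) (hn : 0 < n) (s : ℝ) (hs : 0 < s) (l : List (Fin n)) (hl : l.Nodup) :
    ∫⁻ ω, ENNReal.ofReal (Real.exp (-(s * lS ω l))) ∂(P n)
      ≤ ENNReal.ofReal (1 / (n * s)) ^ (l.length - 1) := by
  have hn' : (0 : ℝ) < n := by exact_mod_cast hn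
  have hpr := P_prob n hn
  have hpe : IsProbabilityMeasure (expMeasure ((n : ℝ)⁻¹)) :=
    isProbabilityMeasure_expMeasure (by positivity)
  induction l with
  | nil => simp [lS]
  | cons u l ih =>
    cases l with
    | nil => simp [lS]
    | cons b l =>
      have hu : u ∉ b :: l := (List.nodup_cons.1 hl).1
      have he : s(u, b) ∉ lE (b :: l) := fun h =>
        hu (mem_of_mem_lE (b :: l) _ h u (Sym2.mem_mk_left u b))
      have hi := ih (List.nodup_cons.1 hl).2
      have hm : Measurable fun ω : Sym2 (Fin n) → ℝ =>
          ENNReal.ofReal (Real.exp (-(s * lS ω (u :: b :: l)))) := by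
        have := measurable_lS (u :: b :: l)
        fun_prop
      unfold P at hi ⊢
      rw [lintegral_coord (expMeasure ((n : ℝ)⁻¹)) s(u, b) _ hm]
      have hin : ∀ ω : Sym2 (Fin n) → ℝ,
          ∫⁻ t, ENNReal.ofReal (Real.exp (-(s * lS (Function.update ω s(u, b) t) (u :: b :: l))))
            ∂(expMeasure ((n : ℝ)⁻¹)) ≤
          ENNReal.ofReal (1 / (n * s)) * ENNReal.ofReal (Real.exp (-(s * lS ω (b :: l)))) := by
        intro ω
        have hin2 : ∀ t, ENNReal.ofReal (Real.exp (-(s * lS (Function.update ω s(u, b) t) (u :: b :: l))))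
            = ENNReal.ofReal (Real.exp (-(s * t))) *
              ENNReal.ofReal (Real.exp (-(s * lS ω (b :: l)))) := by
          intro t
          rw [← ENNReal.ofReal_mul (by positivity), ← Real.exp_add]
          simp only [lS, Function.update_self]
          rw [lS_update _ _ he]
          congr 2
          ring
        simp_rw [hin2]
        rw [lintegral_mul_const' _ _ ENNReal.ofReal_ne_top]
        exact mul_le_mul' (exp_mgf n hn s hs) le_rfl
      refine (lintegral_mono hin).trans ?_
      rw [lintegral_const_mul' _ _ ENNReal.ofReal_ne_top]
      have : (u :: b :: l).length - 1 = ((b :: l).length - 1) + 1 := by simp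
      rw [this, pow_succ']
      exact mul_le_mul' le_rfl hi

lemma prob_path (n ℓ : ℕ) (hn : 0 < n) (lam : ℝ) (hlam : 0 < lam) (γ : Path n ℓ) :
    P n {ω | weight ω γ ≤ lam * ℓ} ≤ ENNReal.ofReal ((Real.exp 1 * lam / n) ^ ℓ) := by
  have hn' : (0 : ℝ) < n := by exact_mod_cast hn
  have h := chern_list n hn (1 / lam) (by positivity) (List.ofFn γ.1)
    (List.nodup_ofFn.2 γ.2)
  have hlen : (List.ofFn γ.1).length - 1 = ℓ := by simp
  rw [hlen, ← ENNReal.ofReal_pow (by positivity)] at h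
  have hsub : {ω | weight ω γ ≤ lam * ℓ} ⊆ {ω | ENNReal.ofReal (Real.exp (-(ℓ : ℝ))) ≤
      ENNReal.ofReal (Real.exp (-(1 / lam * lS ω (List.ofFn γ.1))))} := by
    intro ω hω
    simp only [Set.mem_ofPred_eq] at hω ⊢
    rw [weight_eq] at hω
    apply ENNReal.ofReal_le_ofReal
    apply Real.exp_le_exp.2
    have : 1 / lam * lS ω (List.ofFn γ.1) ≤ ℓ := by
      rw [one_div, inv_mul_le_iff₀ hlam]
      exact hω
    linarith
  have hm : Measurable fun ω : Sym2 (Fin n) → ℝ =>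
      ENNReal.ofReal (Real.exp (-(1 / lam * lS ω (List.ofFn γ.1)))) := by
    have := measurable_lS (List.ofFn γ.1)
    fun_prop
  have hmk := mul_meas_ge_le_lintegral (μ := P n) hm (ENNReal.ofReal (Real.exp (-(ℓ : ℝ))))
  have hfin := hmk.trans h
  calc _ ≤ _ := measure_mono hsub
    _ = ENNReal.ofReal (Real.exp ℓ) * (ENNReal.ofReal (Real.exp (-(ℓ : ℝ))) *
        P n {ω | ENNReal.ofReal (Real.exp (-(ℓ : ℝ))) ≤
      ENNReal.ofReal (Real.exp (-(1 / lam * lS ω (List.ofFn γ.1))))}) := by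
        rw [← mul_assoc, ← ENNReal.ofReal_mul (by positivity), ← Real.exp_add]
        simp
    _ ≤ ENNReal.ofReal (Real.exp ℓ) * ENNReal.ofReal ((1 / (n * (1 / lam))) ^ ℓ) :=
        mul_le_mul' le_rfl hfin
    _ = _ := by
        rw [← ENNReal.ofReal_mul (by positivity)]
        congr 1
        rw [← mul_one (ℓ : ℝ), Real.exp_nat_mul, ← mul_pow]
        congr 1
        field_simp

lemma desc_le (n k : ℕ) (hn : 0 < n) :
    (n.descFactorial (k + 1) : ℝ) ≤ (n : ℝ) ^ (k + 1) * Real.exp (-(k * (k + 1) / (2 * n))) := by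
  have hn' : (0 : ℝ) < n := by exact_mod_cast hn
  induction k with
  | zero => simp
  | succ k ih =>
    rw [Nat.descFactorial_succ]
    push_cast
    have h1 : ((n - (k + 1) : ℕ) : ℝ) ≤ n * Real.exp (-((k + 1) / n)) := by
      rcases le_total (k + 1) n with h | h
      · rw [Nat.cast_sub h]
        have := Real.add_one_le_exp (-(((k : ℝ) + 1) / n))
        calc (n : ℝ) - ((k + 1 : ℕ) : ℝ) = n * (-(((k : ℝ) + 1) / n) + 1) := by
              push_cast; field_simp; ring
          _ ≤ _ := by gcongr
      · rw [Nat.sub_eq_zero_of_le h]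
        simp only [Nat.cast_zero]
        positivity
    calc _ ≤ (n * Real.exp (-((k + 1) / n))) *
          ((n : ℝ) ^ (k + 1) * Real.exp (-(k * (k + 1) / (2 * n)))) := by gcongr
      _ = (n : ℝ) ^ (k + 1 + 1) * (Real.exp (-((k + 1) / n)) *
          Real.exp (-(k * (k + 1) / (2 * n)))) := by ring
      _ = _ := by
        rw [← Real.exp_add]
        congr 2
        field_simp
        ring

lemma term_le (n ℓ : ℕ) (hn : 0 < n) (ε : ℝ) (hε : 0 < ε) (h : 4 * Real.exp 1 * n * ε < ℓ) :
    (n.descFactorial (ℓ + 1) : ℝ) * (Real.exp 1 * (Real.exp (-1) + ε) / n) ^ ℓ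
      ≤ n * Real.exp (-(4 * Real.exp 1 ^ 2 * n * ε ^ 2)) := by
  have hn' : (0 : ℝ) < n := by exact_mod_cast hn
  have he := Real.exp_pos 1
  have e1 : Real.exp 1 * (Real.exp (-1) + ε) = 1 + Real.exp 1 * ε := by
    rw [mul_add, ← Real.exp_add]; simp
  have h1 : (1 + Real.exp 1 * ε) ^ ℓ ≤ Real.exp (ℓ * (Real.exp 1 * ε)) := by
    rw [Real.exp_nat_mul]
    gcongr
    linarith [Real.add_one_le_exp (Real.exp 1 * ε)]
  have h2 := desc_le n ℓ hn
  rw [e1, div_pow]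
  calc _ ≤ ((n : ℝ) ^ (ℓ + 1) * Real.exp (-(ℓ * (ℓ + 1) / (2 * n)))) *
        (Real.exp (ℓ * (Real.exp 1 * ε)) / (n : ℝ) ^ ℓ) := by gcongr
    _ = n * (Real.exp (-(ℓ * (ℓ + 1) / (2 * n))) * Real.exp (ℓ * (Real.exp 1 * ε))) := by
        field_simp
        ring
    _ ≤ _ := by
        rw [← Real.exp_add]
        gcongr
        have h3 : 4 * Real.exp 1 ^ 2 * n * ε ^ 2 * (4 * n) ≤ (ℓ : ℝ) ^ 2 := by
          calc _ = (4 * Real.exp 1 * n * ε) ^ 2 := by ring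
            _ ≤ _ := by gcongr
        have h4 : 4 * Real.exp 1 ^ 2 * n * ε ^ 2 ≤ (ℓ : ℝ) ^ 2 / (4 * n) := by
          rw [le_div_iff₀ (by positivity)]; exact h3
        have h5 : (ℓ : ℝ) * (Real.exp 1 * ε) ≤ ℓ ^ 2 / (4 * n) := by
          rw [le_div_iff₀ (by positivity)]
          calc _ = (ℓ : ℝ) * (4 * Real.exp 1 * n * ε) := by ring
            _ ≤ ℓ * ℓ := by gcongr
            _ = _ := by ring
        have h6 : (ℓ : ℝ) * (ℓ + 1) / (2 * n) = 2 * (ℓ ^ 2 / (4 * n)) + ℓ / (2 * n) := by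
          field_simp; ring
        have h7 : 0 ≤ (ℓ : ℝ) / (2 * n) := by positivity
        linarith

lemma path_bound {n ℓ : ℕ} (γ : Path n ℓ) : ℓ + 1 ≤ n := by
  have := Fintype.card_le_of_injective _ γ.2
  simpa using this

lemma L_bdd (n : ℕ) (lam : ℝ) (ω : Sym2 (Fin n) → ℝ) :
    BddAbove {ℓ : ℕ | ∃ γ : Path n ℓ, weight ω γ ≤ lam * ℓ} :=
  ⟨n, fun _ ⟨γ, _⟩ => (Nat.le_succ _).trans (path_bound γ)⟩

lemma L_mem (n : ℕ) (hn : 0 < n) (lam : ℝ) (ω : Sym2 (Fin n) → ℝ) :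
    ∃ γ : Path n (L n lam ω), weight ω γ ≤ lam * (L n lam ω) := by
  refine Nat.sSup_mem (s := {ℓ : ℕ | ∃ γ : Path n ℓ, weight ω γ ≤ lam * ℓ}) ⟨0, ?_⟩
    (L_bdd n lam ω)
  refine ⟨⟨fun _ => ⟨0, hn⟩, fun a b _ => Subsingleton.elim (α := Fin 1) a b⟩, ?_⟩
  simp [weight]

lemma upper_n (n : ℕ) (hn : 0 < n) (ε : ℝ) (hε : 0 < ε) :
    P n {ω | ¬ ((L n (Real.exp (-1) + ε) ω : ℝ) ≤ 4 * Real.exp 1 * n * ε)}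
      ≤ ENNReal.ofReal (n * (n * Real.exp (-(4 * Real.exp 1 ^ 2 * n * ε ^ 2)))) := by
  have hn' : (0 : ℝ) < n := by exact_mod_cast hn
  have he := Real.exp_pos (-1)
  have hsub : {ω | ¬ ((L n (Real.exp (-1) + ε) ω : ℝ) ≤ 4 * Real.exp 1 * n * ε)} ⊆
      ⋃ ℓ ∈ (Finset.range n).filter (fun ℓ : ℕ => 4 * Real.exp 1 * n * ε < (ℓ : ℝ)),
        ⋃ γ ∈ (Finset.univ : Finset (Path n ℓ)), {ω | weight ω γ ≤ (Real.exp (-1) + ε) * ℓ} := by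
    intro ω hω
    simp only [Set.mem_ofPred_eq, not_le] at hω
    obtain ⟨γ, hγ⟩ := L_mem n hn (Real.exp (-1) + ε) ω
    simp only [Set.mem_iUnion]
    exact ⟨L n (Real.exp (-1) + ε) ω,
      Finset.mem_filter.2 ⟨Finset.mem_range.2 (path_bound γ), hω⟩, γ, Finset.mem_univ _, hγ⟩
  refine (measure_mono hsub).trans ?_
  refine (measure_biUnion_finset_le _ _).trans ?_
  calc _ ≤ ∑ ℓ ∈ (Finset.range n).filter (fun ℓ : ℕ => 4 * Real.exp 1 * n * ε < (ℓ : ℝ)),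
        ENNReal.ofReal (n * Real.exp (-(4 * Real.exp 1 ^ 2 * n * ε ^ 2))) := by
        refine Finset.sum_le_sum fun ℓ hℓ => ?_
        refine (measure_biUnion_finset_le _ _).trans ?_
        refine (Finset.sum_le_sum fun γ _ => prob_path n ℓ hn _ (by positivity) γ).trans ?_
        rw [Finset.sum_const, Finset.card_univ, card_path, nsmul_eq_mul,
          ← ENNReal.ofReal_natCast, ← ENNReal.ofReal_mul (by positivity)]
        exact ENNReal.ofReal_le_ofReal (term_le n ℓ hn ε hε (Finset.mem_filter.1 hℓ).2)
    _ ≤ ∑ ℓ ∈ Finset.range n,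
        ENNReal.ofReal (n * Real.exp (-(4 * Real.exp 1 ^ 2 * n * ε ^ 2))) :=
        Finset.sum_le_sum_of_subset (Finset.filter_subset _ _)
    _ = _ := by
        rw [Finset.sum_const, Finset.card_range, nsmul_eq_mul, ← ENNReal.ofReal_natCast,
          ← ENNReal.ofReal_mul (by positivity)]

lemma upper_lim : ∀ᶠ n : ℕ in atTop, ∀ ε : ℝ,
    128 * Real.pi ^ 2 * ((Real.log n) ^ 2)⁻¹ ≤ ε →
    P n {ω | ¬ ((L n (Real.exp (-1) + ε) ω : ℝ) ≤ 4 * Real.exp 1 * n * ε)}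
      ≤ ENNReal.ofReal (1 / n) := by
  have hlog : Tendsto (fun n : ℕ => Real.log n) atTop atTop :=
    Real.tendsto_log_atTop.comp tendsto_natCast_atTop_atTop
  have ho : ∀ᶠ n : ℕ in atTop, Real.log n ^ 5 ≤ 1 / 3 * n := by
    have h := (Real.isLittleO_pow_log_id_atTop (n := 5)).bound (by norm_num : (0 : ℝ) < 1 / 3)
    filter_upwards [tendsto_natCast_atTop_atTop.eventually h] with n hn
    simp only [id, Real.norm_eq_abs, Nat.abs_cast] at hn
    exact (le_abs_self _).trans hn
  filter_upwards [eventually_gt_atTop 0, hlog.eventually_ge_atTop 1, ho] with n hn h1 h2 ε hε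
  have hn' : (0 : ℝ) < n := by exact_mod_cast hn
  have hpi := Real.pi_gt_three
  have hl0 : 0 < Real.log n := by linarith
  have hε1 : ((Real.log n) ^ 2)⁻¹ ≤ ε := by
    refine le_trans ?_ hε
    have : 0 ≤ ((Real.log n) ^ 2)⁻¹ := by positivity
    have h4 : 1 ≤ 128 * Real.pi ^ 2 := by nlinarith
    exact le_mul_of_one_le_left this h4
  have hε0 : 0 < ε := lt_of_lt_of_le (by positivity) hε1
  refine (upper_n n hn ε hε0).trans (ENNReal.ofReal_le_ofReal ?_)
  have h3 : 3 * Real.log n ≤ 4 * Real.exp 1 ^ 2 * n * ε ^ 2 := by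
    have he : 1 ≤ Real.exp 1 := Real.one_le_exp (by norm_num)
    have h4 : 3 * Real.log n ≤ n * (((Real.log n) ^ 2)⁻¹) ^ 2 := by
      rw [inv_pow, ← div_eq_mul_inv, le_div_iff₀ (by positivity)]
      calc _ = 3 * Real.log n ^ 5 := by ring
        _ ≤ _ := by linarith
    calc _ ≤ n * (((Real.log n) ^ 2)⁻¹) ^ 2 := h4
      _ ≤ n * ε ^ 2 := by gcongr
      _ = 1 * 1 ^ 2 * n * ε ^ 2 := by ring
      _ ≤ _ := by gcongr; norm_num
  calc _ ≤ (n : ℝ) * (n * Real.exp (-(3 * Real.log n))) := by gcongr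
    _ = 1 / n := by
      have : Real.exp (-(3 * Real.log n)) = ((n : ℝ) ^ 3)⁻¹ := by
        rw [Real.exp_neg]
        congr 1
        have := Real.exp_nat_mul (Real.log n) 3
        push_cast at this
        rw [this, Real.exp_log hn']
      rw [this]
      field_simp

end upper

end helpers

/-- Theorem 2 (supercritical regime): there are absolute constants β, C > 0 such that
uniformly over λ ≥ e⁻¹ + β (log n)⁻², with probability tending to one,
n^(1/4) ≤ L(n,λ) ≤ C n (λ - e⁻¹). -/
theorem supercritical :
    ∃ β C : ℝ, 0 < β ∧ 0 < C ∧
      Tendsto (fun n : ℕ =>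
          ⨅ lam ∈ Set.Ici (Real.exp (-1) + β * ((Real.log n) ^ 2)⁻¹),
            P n {ω | (n : ℝ) ^ ((1 : ℝ) / 4) ≤ (L n lam ω : ℝ) ∧
                     (L n lam ω : ℝ) ≤ C * n * (lam - Real.exp (-1))})
        atTop (nhds 1) := by
  refine ⟨128 * Real.pi ^ 2, 4 * Real.exp 1, by positivity, by positivity, ?_⟩
  obtain ⟨a, ha, hev⟩ := lower_lim
  have hlow : Tendsto (fun n : ℕ => ENNReal.ofReal (a n) - ENNReal.ofReal (1 / n)) atTop
      (nhds 1) := by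
    have h1 : Tendsto (fun n : ℕ => a n - 1 / (n : ℝ)) atTop (nhds (1 - 0)) :=
      ha.sub tendsto_one_div_atTop_nhds_zero_nat
    have h2 := (ENNReal.continuous_ofReal.tendsto _).comp h1
    rw [sub_zero, ENNReal.ofReal_one] at h2
    refine h2.congr fun n => ?_
    simp only [Function.comp]
    exact ENNReal.ofReal_sub _ (by positivity)
  refine tendsto_of_tendsto_of_tendsto_of_le_of_le' hlow tendsto_const_nhds ?_ ?_
  · filter_upwards [hev, upper_lim, eventually_gt_atTop 0] with n h1 h2 hn
    obtain ⟨A, hA, hA1, hA2⟩ := h1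
    have hpr := P_prob n hn
    refine le_iInf₂ fun lam hlam => ?_
    have hlam' : Real.exp (-1) + 128 * Real.pi ^ 2 * ((Real.log n) ^ 2)⁻¹ ≤ lam := hlam
    have hb := h2 (lam - Real.exp (-1)) (by linarith)
    rw [add_sub_cancel] at hb
    rw [tsub_le_iff_right]
    refine hA2.trans ?_
    refine le_trans (measure_mono ?_) ((measure_union_le _ _).trans (add_le_add le_rfl hb))
    intro ω hω
    by_cases hc : (L n lam ω : ℝ) ≤ 4 * Real.exp 1 * n * (lam - Real.exp (-1))
    · left
      refine ⟨?_, hc⟩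
      obtain ⟨m, hm, γ, hγ⟩ := hA1 ω hω
      refine hm.trans ?_
      have : m ≤ L n lam ω := le_csSup (L_bdd n lam ω) ⟨γ, hγ.trans (by gcongr)⟩
      exact_mod_cast this
    · right
      exact hc
  · filter_upwards [eventually_gt_atTop 0] with n hn
    have hpr := P_prob n hn
    exact (iInf₂_le _ Set.self_mem_Ici).trans prob_le_one

end Paper
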